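/- arXiv:2206.04353 — 3 statements merged into one kernel-verified Lean document; each statement's English description precedes it below -/
import Mathlib

section
/- Let N ≥ 1 be an integer, s ∈ (0,1) with N > 2s, and 1 < p ≤ N/(N-2s). Then E_{-1}^+ = {0}: every nonnegative u ∈ C(cl(ℝ^{N+1}_+)∖{0}) ∩ C²(ℝ^{N+1}_+) that is positively homogeneous of degree -2s/(p-1), satisfies div(z^{1-2s}∇u) = 0 in ℝ^{N+1}_+ and ∂_{ν^s}u(x,0) - u(x,0)^p = 0 for every x ∈ ℝ^N∖{0}, is identically zero. -/
open MeasureTheory Filter Topology Set Metric Asymptotics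

noncomputable section

/-- Euclidean space `ℝ^N`. -/
abbrev Euc (N : ℕ) : Type := EuclideanSpace ℝ (Fin N)

/-- Second derivative of `u` at `q` in the direction `v`. -/
noncomputable def d2 {N : ℕ} (u : Euc N × ℝ → ℝ) (q v : Euc N × ℝ) : ℝ :=
  fderiv ℝ (fun w => fderiv ℝ u w v) q v

/-- The Caffarelli–Silvestre operator `div(z^{1-2s} ∇u)` written out pointwise:
`z^{1-2s} Δu + (1-2s) z^{-2s} ∂_z u`. -/
noncomputable def CSop (N : ℕ) (s : ℝ) (u : Euc N × ℝ → ℝ) (q : Euc N × ℝ) : ℝ :=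
  q.2 ^ (1 - 2*s) *
      ((∑ i : Fin N, d2 u q (EuclideanSpace.single i (1:ℝ), (0:ℝ))) +
        d2 u q ((0 : Euc N), (1:ℝ)))
    + (1 - 2*s) * q.2 ^ (-(2*s)) * fderiv ℝ u q ((0 : Euc N), (1:ℝ))

/-- The normalizing constant `C_{N,s}` of the Poisson kernel, determined by
`C_{N,s} ∫ (|y|²+1)^{-(N+2s)/2} dy = 1`. -/
noncomputable def PoissonConst (N : ℕ) (s : ℝ) : ℝ :=
  (∫ y : Euc N, (‖y‖^2 + 1) ^ (-((N:ℝ) + 2*s)/2))⁻¹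

/-- The normalizing constant `c_{N,s}` of the fractional Laplacian. -/
noncomputable def cNs (N : ℕ) (s : ℝ) : ℝ :=
  2 ^ (2*s) * Real.pi ^ (-(N:ℝ)/2) * Real.Gamma (((N:ℝ) + 2*s)/2) / Real.Gamma (1 - s)

/-- The truncated integral appearing in the principal-value definition of `(-Δ)^s`. -/
noncomputable def fLapApprox (N : ℕ) (s : ℝ) (w : Euc N → ℝ) (x : Euc N) (ε : ℝ) : ℝ :=
  cNs N s * ∫ y in {y : Euc N | ε < dist x y}, (w x - w y) / dist x y ^ ((N:ℝ) + 2*s)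

/-- `(-Δ)^s w (x) = L` in the principal-value sense. -/
def HasFracLap (N : ℕ) (s : ℝ) (w : Euc N → ℝ) (x : Euc N) (L : ℝ) : Prop :=
  Tendsto (fLapApprox N s w x) (𝓝[>] (0:ℝ)) (𝓝 L)

/-- The fractional Laplacian `(-Δ)^s w (x)`, as a limit (junk value if the limit
does not exist). -/
noncomputable def fracLap (N : ℕ) (s : ℝ) (w : Euc N → ℝ) (x : Euc N) : ℝ :=
  limUnder (𝓝[>] (0:ℝ)) (fLapApprox N s w x)

/-- `w ∈ L¹_{μ_s}(ℝ^N)`, where `μ_s(x) = (1+|x|)^{-N-2s}`. -/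
def L1mu (N : ℕ) (s : ℝ) (w : Euc N → ℝ) : Prop :=
  Integrable (fun x : Euc N => w x * (1 + ‖x‖) ^ (-((N:ℝ) + 2*s)))

/-- The set `E_ε` of self-similar solutions of the lifted fractional Emden equation:
continuous on the closed half-space minus the origin, `C²` in the open half-space,
positively homogeneous of degree `-2s/(p-1)`, satisfying `div(z^{1-2s}∇u) = 0`
in the open half-space, and `∂_{ν^s}u(x,0) + ε|u(x,0)|^{p-1}u(x,0) = 0` for `x ≠ 0`,
where `∂_{ν^s}u(x,0) = -lim_{z→0⁺} z^{1-2s}∂_z u(x,z)`. -/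
def SelfSim (N : ℕ) (s p ε : ℝ) : Set (Euc N × ℝ → ℝ) :=
  {u | ContinuousOn u ({q : Euc N × ℝ | 0 ≤ q.2} \ {0}) ∧
       ContDiffOn ℝ 2 u {q : Euc N × ℝ | 0 < q.2} ∧
       (∀ l : ℝ, 0 < l → ∀ q : Euc N × ℝ, u (l • q.1, l * q.2) = l ^ (-(2*s)/(p-1)) * u q) ∧
       (∀ q : Euc N × ℝ, 0 < q.2 → CSop N s u q = 0) ∧
       (∀ x : Euc N, x ≠ 0 →
          Tendsto (fun z : ℝ => z ^ (1 - 2*s) * fderiv ℝ u (x, z) ((0 : Euc N), (1:ℝ)))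
            (𝓝[>] (0:ℝ)) (𝓝 (ε * |u (x, 0)| ^ (p-1) * u (x, 0))))}

/-- The subset `E_ε⁺` of nonnegative elements of `E_ε`. -/
def SelfSimPos (N : ℕ) (s p ε : ℝ) : Set (Euc N × ℝ → ℝ) :=
  {u ∈ SelfSim N s p ε | ∀ q : Euc N × ℝ, 0 ≤ q.2 → 0 ≤ u q}

/-- The constant `C_s(τ)` such that `(-Δ)^s |x|^τ = C_s(τ)|x|^{τ-2s}`. -/
noncomputable def Cs (N : ℕ) (s τ : ℝ) : ℝ :=
  2 ^ (2*s) * Real.Gamma (((N:ℝ) + τ)/2) * Real.Gamma ((2*s - τ)/2) /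
    (Real.Gamma (-τ/2) * Real.Gamma (((N:ℝ) - 2*s + τ)/2))

/-- The constant `c_p = C_s(-2s/(p-1))^{1/(p-1)}`. -/
noncomputable def cp (N : ℕ) (s p : ℝ) : ℝ := (Cs N s (-(2*s)/(p-1))) ^ (1/(p-1))

end

section LineDerivatives

variable {N : ℕ}

lemma ContDiffAt.eventually_hasDerivAt_line {f : Euc N × ℝ → ℝ} {q : Euc N × ℝ}
    (hf : ContDiffAt ℝ 2 f q) (v : Euc N × ℝ) :
    ∀ᶠ t : ℝ in 𝓝 0, HasDerivAt (fun t : ℝ => f (q + t • v)) (fderiv ℝ f (q + t • v) v) t := by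
  have hc : Tendsto (fun t : ℝ => q + t • v) (𝓝 0) (𝓝 q) := by
    have : Continuous fun t : ℝ => q + t • v := by fun_prop
    simpa using this.tendsto 0
  filter_upwards [hc.eventually (hf.eventually (by simp))] with t ht
  have h1 : HasDerivAt (fun t : ℝ => q + t • v) v t := by
    simpa using ((hasDerivAt_id t).smul_const v).const_add q
  exact (ht.differentiableAt (by simp)).hasFDerivAt.comp_hasDerivAt t h1

lemma ContDiffAt.differentiableAt_fderiv_apply {f : Euc N × ℝ → ℝ} {q : Euc N × ℝ}
    (hf : ContDiffAt ℝ 2 f q) (v : Euc N × ℝ) :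
    DifferentiableAt ℝ (fun w => fderiv ℝ f w v) q := by
  have h : ContDiffAt ℝ 1 (fderiv ℝ f) q := hf.fderiv_right (by norm_num)
  exact (h.differentiableAt (by simp)).clm_apply (differentiableAt_const v)

lemma ContDiffAt.hasDerivAt_fderiv_line {f : Euc N × ℝ → ℝ} {q : Euc N × ℝ}
    (hf : ContDiffAt ℝ 2 f q) (v : Euc N × ℝ) :
    HasDerivAt (fun t : ℝ => fderiv ℝ f (q + t • v) v) (d2 f q v) 0 := by
  have h1 : HasDerivAt (fun t : ℝ => q + t • v) v 0 := by
    simpa using ((hasDerivAt_id (0 : ℝ)).smul_const v).const_add q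
  have h2 : HasFDerivAt (fun w => fderiv ℝ f w v) (fderiv ℝ (fun w => fderiv ℝ f w v) q)
      (q + (0 : ℝ) • v) := by
    simpa using (hf.differentiableAt_fderiv_apply v).hasFDerivAt
  exact h2.comp_hasDerivAt 0 h1

/-- Directional first and second derivatives may be computed along a line. -/
lemma fderiv_eq_and_d2_eq_of_line {f : Euc N × ℝ → ℝ} {q v : Euc N × ℝ}
    (hf : ContDiffAt ℝ 2 f q) {g : ℝ → ℝ} {b : ℝ}
    (hg : ∀ᶠ t : ℝ in 𝓝 0, HasDerivAt (fun t : ℝ => f (q + t • v)) (g t) t)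
    (hb : HasDerivAt g b 0) : fderiv ℝ f q v = g 0 ∧ d2 f q v = b := by
  have h : (fun t : ℝ => fderiv ℝ f (q + t • v) v) =ᶠ[𝓝 0] g := by
    filter_upwards [hf.eventually_hasDerivAt_line v, hg] with t h1 h2 using h1.unique h2
  refine ⟨by simpa using h.eq_of_nhds, ?_⟩
  exact (hf.hasDerivAt_fderiv_line v).unique (hb.congr_of_eventuallyEq h)

lemma IsLocalMin.d2_nonneg {f : Euc N × ℝ → ℝ} {q : Euc N × ℝ}
    (hmin : IsLocalMin f q) (hf : ContDiffAt ℝ 2 f q) (v : Euc N × ℝ) : 0 ≤ d2 f q v := by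
  by_contra! hneg
  set g : ℝ → ℝ := fun t => f (q + t • v) with hg
  have hc : Tendsto (fun t : ℝ => q + t • v) (𝓝 0) (𝓝 q) := by
    have : Continuous fun t : ℝ => q + t • v := by fun_prop
    simpa using this.tendsto 0
  have hgmin : IsLocalMin g 0 := by
    filter_upwards [hc.eventually hmin] with t ht
    simpa [hg] using ht
  have hev := hf.eventually_hasDerivAt_line v
  have hderiv : deriv g =ᶠ[𝓝 0] fun t => fderiv ℝ f (q + t • v) v := by
    filter_upwards [hev] with t ht using ht.deriv
  have hdd : deriv (deriv g) 0 = d2 f q v := by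
    rw [hderiv.deriv_eq]
    exact (hf.hasDerivAt_fderiv_line v).deriv
  have hgmax : IsLocalMax g 0 :=
    isLocalMax_of_deriv_deriv_neg (by rw [hdd]; exact hneg) hgmin.deriv_eq_zero
      hev.self_of_nhds.continuousAt
  have hconst : g =ᶠ[𝓝 0] fun _ => g 0 := by
    filter_upwards [hgmin, hgmax] with t h1 h2 using le_antisymm h2 h1
  have : deriv (deriv g) 0 = 0 := by
    rw [hconst.deriv.deriv_eq]
    simp
  rw [hdd] at this
  exact hneg.ne this

lemma IsLocalMin.CSop_nonneg {s : ℝ} {f : Euc N × ℝ → ℝ} {q : Euc N × ℝ}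
    (hmin : IsLocalMin f q) (hf : ContDiffAt ℝ 2 f q) (hq : 0 < q.2) : 0 ≤ CSop N s f q := by
  have h0 : fderiv ℝ f q = 0 := hmin.fderiv_eq_zero
  simp only [CSop, h0, zero_apply, mul_zero, add_zero]
  have := Finset.sum_nonneg (s := Finset.univ) fun (i : Fin N) _ =>
    hmin.d2_nonneg hf (EuclideanSpace.single i (1 : ℝ), (0 : ℝ))
  have := hmin.d2_nonneg hf ((0 : Euc N), (1 : ℝ))
  positivity

lemma fderiv_sub_const_mul_apply {f g : Euc N × ℝ → ℝ} {q : Euc N × ℝ}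
    (hf : DifferentiableAt ℝ f q) (hg : DifferentiableAt ℝ g q) (k : ℝ) (v : Euc N × ℝ) :
    fderiv ℝ (fun w => f w - k * g w) q v = fderiv ℝ f q v - k * fderiv ℝ g q v := by
  rw [fderiv_fun_sub hf (hg.const_mul k), fderiv_const_mul hg k]
  simp

lemma d2_sub_const_mul {f g : Euc N × ℝ → ℝ} {q : Euc N × ℝ}
    (hf : ContDiffAt ℝ 2 f q) (hg : ContDiffAt ℝ 2 g q) (k : ℝ) (v : Euc N × ℝ) :
    d2 (fun w => f w - k * g w) q v = d2 f q v - k * d2 g q v := by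
  have h : (fun w => fderiv ℝ (fun w => f w - k * g w) w v) =ᶠ[𝓝 q]
      fun w => fderiv ℝ f w v - k * fderiv ℝ g w v := by
    filter_upwards [hf.eventually (by simp), hg.eventually (by simp)] with w h1 h2
    exact fderiv_sub_const_mul_apply (h1.differentiableAt (by simp))
      (h2.differentiableAt (by simp)) k v
  rw [d2, h.fderiv_eq, fderiv_sub_const_mul_apply (hf.differentiableAt_fderiv_apply v)
    (hg.differentiableAt_fderiv_apply v)]
  rfl

lemma CSop_sub_const_mul {s : ℝ} {f g : Euc N × ℝ → ℝ} {q : Euc N × ℝ}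
    (hf : ContDiffAt ℝ 2 f q) (hg : ContDiffAt ℝ 2 g q) (k : ℝ) :
    CSop N s (fun w => f w - k * g w) q = CSop N s f q - k * CSop N s g q := by
  simp only [CSop, d2_sub_const_mul hf hg, Finset.sum_sub_distrib, ← Finset.mul_sum,
    fderiv_sub_const_mul_apply (hf.differentiableAt (by simp)) (hg.differentiableAt (by simp))]
  ring

end LineDerivatives

section Barrier

variable {N : ℕ}

/-- The functions `z^A (|x-x₀|² + z² + c)^{-μ}` from which all barriers are built. -/
noncomputable def barrier (x₀ : Euc N) (A μ c : ℝ) (q : Euc N × ℝ) : ℝ :=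
  q.2 ^ A * (‖q.1 - x₀‖ ^ 2 + q.2 ^ 2 + c) ^ (-μ)

lemma barrier_base_pos (x₀ : Euc N) {c : ℝ} (hc : 0 ≤ c) {q : Euc N × ℝ} (hq : 0 < q.2) :
    0 < ‖q.1 - x₀‖ ^ 2 + q.2 ^ 2 + c := by positivity

lemma barrier_pos (x₀ : Euc N) (A μ : ℝ) {c : ℝ} (hc : 0 ≤ c) {q : Euc N × ℝ} (hq : 0 < q.2) :
    0 < barrier x₀ A μ c q := by
  have := barrier_base_pos x₀ hc hq
  unfold barrier
  positivity

lemma contDiffAt_barrier (x₀ : Euc N) (A μ : ℝ) {c : ℝ} (hc : 0 ≤ c) {q : Euc N × ℝ}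
    (hq : 0 < q.2) : ContDiffAt ℝ 2 (barrier x₀ A μ c) q := by
  have h1 : ContDiffAt ℝ 2 (fun q : Euc N × ℝ => q.2) q := contDiffAt_snd
  have h2 : ContDiffAt ℝ 2 (fun q : Euc N × ℝ => ‖q.1 - x₀‖ ^ 2 + q.2 ^ 2 + c) q :=
    (((contDiffAt_fst.sub contDiffAt_const).norm_sq ℝ).add (h1.pow 2)).add contDiffAt_const
  exact (h1.rpow_const_of_ne hq.ne').mul
    (h2.rpow_const_of_ne (barrier_base_pos x₀ hc hq).ne')

lemma hasDerivAt_barrier_line {z ρ k b A μ t : ℝ} (hz : 0 < z + t * k)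
    (hρ : 0 < ρ + 2 * b * t + t ^ 2) :
    HasDerivAt (fun t : ℝ => (z + t * k) ^ A * (ρ + 2 * b * t + t ^ 2) ^ (-μ))
      (k * A * (z + t * k) ^ (A - 1) * (ρ + 2 * b * t + t ^ 2) ^ (-μ)
        + (z + t * k) ^ A *
          ((2 * b + 2 * t) * (-μ) * (ρ + 2 * b * t + t ^ 2) ^ (-μ - 1))) t := by
  have h1 : HasDerivAt (fun t : ℝ => z + t * k) k t := by
    simpa using ((hasDerivAt_id t).mul_const k).const_add z
  have h2 : HasDerivAt (fun t : ℝ => ρ + 2 * b * t + t ^ 2) (2 * b + 2 * t) t := by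
    simpa using (((hasDerivAt_id t).const_mul (2 * b)).const_add ρ).fun_add
      (hasDerivAt_pow 2 t)
  exact (h1.rpow_const (Or.inl hz.ne')).mul (h2.rpow_const (Or.inl hρ.ne'))

lemma hasDerivAt_deriv_barrier_line {z ρ k b A μ : ℝ} (hz : 0 < z) (hρ : 0 < ρ) :
    HasDerivAt (fun t : ℝ => k * A * (z + t * k) ^ (A - 1) * (ρ + 2 * b * t + t ^ 2) ^ (-μ)
        + (z + t * k) ^ A *
          ((2 * b + 2 * t) * (-μ) * (ρ + 2 * b * t + t ^ 2) ^ (-μ - 1)))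
      (z ^ A * ρ ^ (-μ) * (k ^ 2 * A * (A - 1) / z ^ 2 - 4 * k * A * b * μ / (z * ρ)
        + 4 * b ^ 2 * μ * (μ + 1) / ρ ^ 2 - 2 * μ / ρ)) 0 := by
  have h1 : HasDerivAt (fun t : ℝ => z + t * k) k 0 := by
    simpa using ((hasDerivAt_id (0 : ℝ)).mul_const k).const_add z
  have h2 : HasDerivAt (fun t : ℝ => ρ + 2 * b * t + t ^ 2) (2 * b) 0 := by
    simpa using (((hasDerivAt_id (0 : ℝ)).const_mul (2 * b)).const_add ρ).fun_add
      (hasDerivAt_pow 2 (0 : ℝ))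
  have h3 : HasDerivAt (fun t : ℝ => (2 * b + 2 * t) * (-μ)) (2 * (-μ)) 0 := by
    simpa using (((hasDerivAt_id (0 : ℝ)).const_mul 2).const_add (2 * b)).mul_const (-μ)
  have hz0 : z + 0 * k ≠ 0 := by simpa using hz.ne'
  have hρ0 : ρ + 2 * b * 0 + 0 ^ 2 ≠ 0 := by simpa using hρ.ne'
  have key := (((h1.rpow_const (p := A - 1) (Or.inl hz0)).const_mul (k * A)).mul
    (h2.rpow_const (p := -μ) (Or.inl hρ0))).add
    ((h1.rpow_const (p := A) (Or.inl hz0)).mul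
      (h3.fun_mul (h2.rpow_const (p := -μ - 1) (Or.inl hρ0))))
  refine key.congr_deriv ?_
  simp only [zero_mul, mul_zero, add_zero, ne_eq, OfNat.ofNat_ne_zero, not_false_eq_true,
    zero_pow, Real.rpow_sub_one hz.ne', Real.rpow_sub_one hρ.ne']
  field_simp
  ring

lemma barrier_line (x₀ : Euc N) (A μ c : ℝ) (q v : Euc N × ℝ)
    (hv : ‖v.1‖ ^ 2 + v.2 ^ 2 = 1) (t : ℝ) :
    barrier x₀ A μ c (q + t • v) = (q.2 + t * v.2) ^ A *
      ((‖q.1 - x₀‖ ^ 2 + q.2 ^ 2 + c) + 2 * (inner ℝ (q.1 - x₀) v.1 + q.2 * v.2) * t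
        + t ^ 2) ^ (-μ) := by
  have h : ‖q.1 + t • v.1 - x₀‖ ^ 2 =
      ‖q.1 - x₀‖ ^ 2 + 2 * t * inner ℝ (q.1 - x₀) v.1 + t ^ 2 * ‖v.1‖ ^ 2 := by
    rw [show q.1 + t • v.1 - x₀ = (q.1 - x₀) + t • v.1 by abel, norm_add_sq_real,
      inner_smul_right, norm_smul, mul_pow, Real.norm_eq_abs, sq_abs]
    ring
  simp only [barrier, Prod.fst_add, Prod.snd_add, Prod.smul_fst, Prod.smul_snd, smul_eq_mul, h]
  congr 2
  linear_combination t ^ 2 * hv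

lemma barrier_derivs (x₀ : Euc N) (A μ : ℝ) {c : ℝ} (hc : 0 ≤ c) {q : Euc N × ℝ}
    (hq : 0 < q.2) {v : Euc N × ℝ} (hv : ‖v.1‖ ^ 2 + v.2 ^ 2 = 1) {ρ b : ℝ}
    (hρ : ρ = ‖q.1 - x₀‖ ^ 2 + q.2 ^ 2 + c) (hb : b = inner ℝ (q.1 - x₀) v.1 + q.2 * v.2) :
    fderiv ℝ (barrier x₀ A μ c) q v
        = q.2 ^ A * ρ ^ (-μ) * (v.2 * A / q.2 - 2 * b * μ / ρ) ∧
    d2 (barrier x₀ A μ c) q v =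
      q.2 ^ A * ρ ^ (-μ) * (v.2 ^ 2 * A * (A - 1) / q.2 ^ 2 - 4 * v.2 * A * b * μ / (q.2 * ρ)
        + 4 * b ^ 2 * μ * (μ + 1) / ρ ^ 2 - 2 * μ / ρ) := by
  have hρ0 : 0 < ρ := hρ ▸ barrier_base_pos x₀ hc hq
  have hev : ∀ᶠ t : ℝ in 𝓝 0, HasDerivAt (fun t : ℝ => barrier x₀ A μ c (q + t • v))
      (v.2 * A * (q.2 + t * v.2) ^ (A - 1) * (ρ + 2 * b * t + t ^ 2) ^ (-μ)
        + (q.2 + t * v.2) ^ A *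
          ((2 * b + 2 * t) * (-μ) * (ρ + 2 * b * t + t ^ 2) ^ (-μ - 1))) t := by
    have c1 : ContinuousAt (fun t : ℝ => q.2 + t * v.2) 0 := by fun_prop
    have c2 : ContinuousAt (fun t : ℝ => ρ + 2 * b * t + t ^ 2) 0 := by fun_prop
    filter_upwards [c1.eventually (lt_mem_nhds (by simpa using hq)),
      c2.eventually (lt_mem_nhds (by simpa using hρ0))] with t h1 h2
    simp only [barrier_line x₀ A μ c q v hv, ← hρ, ← hb]
    exact hasDerivAt_barrier_line h1 h2
  obtain ⟨e1, e2⟩ := fderiv_eq_and_d2_eq_of_line (contDiffAt_barrier x₀ A μ hc hq) hev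
    (hasDerivAt_deriv_barrier_line hq hρ0)
  refine ⟨?_, e2⟩
  rw [e1]
  simp only [zero_mul, mul_zero, add_zero, ne_eq, OfNat.ofNat_ne_zero, not_false_eq_true,
    zero_pow, Real.rpow_sub_one hq.ne', Real.rpow_sub_one hρ0.ne']
  field_simp
  ring

lemma CSop_barrier (s : ℝ) (x₀ : Euc N) (A μ : ℝ) {c : ℝ} (hc : 0 ≤ c) {q : Euc N × ℝ}
    (hq : 0 < q.2) {ρ : ℝ} (hρ : ρ = ‖q.1 - x₀‖ ^ 2 + q.2 ^ 2 + c) :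
    CSop N s (barrier x₀ A μ c) q = q.2 ^ (1 - 2 * s) * barrier x₀ A μ c q *
      (A * (A - 2 * s) / q.2 ^ 2 + 2 * μ * (2 * μ - N + 2 * s - 2 * A) / ρ
        - 4 * μ * (μ + 1) * c / ρ ^ 2) := by
  have hρ0 : 0 < ρ := hρ ▸ barrier_base_pos x₀ hc hq
  have hz := barrier_derivs x₀ A μ hc hq (v := ((0 : Euc N), (1 : ℝ))) (by simp) hρ
    (b := q.2) (by simp)
  have hx : ∀ i : Fin N, d2 (barrier x₀ A μ c) q (EuclideanSpace.single i (1 : ℝ), (0 : ℝ)) =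
      q.2 ^ A * ρ ^ (-μ) * (4 * μ * (μ + 1) / ρ ^ 2) * (q.1 - x₀) i ^ 2
        - q.2 ^ A * ρ ^ (-μ) * (2 * μ / ρ) := by
    intro i
    rw [(barrier_derivs x₀ A μ hc hq (v := (EuclideanSpace.single i (1 : ℝ), (0 : ℝ)))
      (by simp) hρ (b := (q.1 - x₀) i) (by simp [EuclideanSpace.inner_single_right])).2]
    ring
  have hb : barrier x₀ A μ c q = q.2 ^ A * ρ ^ (-μ) := by rw [hρ]; rfl
  have hn : ∑ i : Fin N, (q.1 - x₀) i ^ 2 = ρ - q.2 ^ 2 - c := by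
    rw [hρ, EuclideanSpace.real_norm_sq_eq]
    ring
  have hpow : q.2 ^ (-(2 * s)) = q.2 ^ (1 - 2 * s) / q.2 := by
    rw [← Real.rpow_sub_one hq.ne']
    congr 1
    ring
  simp only [CSop, hx, Finset.sum_sub_distrib, ← Finset.mul_sum, hn, hz.1, hz.2, hb, hpow,
    Finset.sum_const, Finset.card_univ, Fintype.card_fin, nsmul_eq_mul]
  field_simp
  ring

end Barrier

section MaximumPrinciple

variable {N : ℕ}

lemma contDiffAt_of_pos {f : Euc N × ℝ → ℝ} (hf : ContDiffOn ℝ 2 f {q | 0 < q.2})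
    {q : Euc N × ℝ} (hq : 0 < q.2) : ContDiffAt ℝ 2 f q :=
  hf.contDiffAt ((isOpen_lt continuous_const continuous_snd).mem_nhds hq)

lemma continuous_barrier (x₀ : Euc N) {A : ℝ} (hA : 0 ≤ A) (μ : ℝ) {c : ℝ} (hc : 0 < c) :
    Continuous (barrier x₀ A μ c) := by
  have h1 : Continuous fun q : Euc N × ℝ => q.2 ^ A :=
    continuous_snd.rpow_const fun _ => Or.inr hA
  have h2 : Continuous fun q : Euc N × ℝ => ‖q.1 - x₀‖ ^ 2 + q.2 ^ 2 + c := by fun_prop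
  exact h1.mul (h2.rpow_const fun q => Or.inl (by positivity))

/-- Superlevel sets of a decaying barrier are compact in the open half-space. -/
lemma isCompact_barrier_superlevel (x₀ : Euc N) {A μ c ε : ℝ} (hA : 0 < A) (hAμ : A / 2 < μ)
    (hc : 0 < c) (hε : 0 < ε) :
    IsCompact {q : Euc N × ℝ | 0 ≤ q.2 ∧ ε ≤ barrier x₀ A μ c q} := by
  set κ := μ - A / 2 with hκ
  have hκ0 : 0 < κ := by linarith
  set R := (ε⁻¹) ^ (1 / κ) with hR
  refine (isCompact_closedBall ((x₀, 0) : Euc N × ℝ) (√R)).of_isClosed_subset ?_ ?_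
  · exact (isClosed_le continuous_const continuous_snd).inter
      (isClosed_le continuous_const (continuous_barrier x₀ hA.le μ hc))
  · rintro q ⟨hz, hq⟩
    set ρ := ‖q.1 - x₀‖ ^ 2 + q.2 ^ 2 + c with hρ
    have hρ0 : 0 < ρ := by positivity
    have h1 : q.2 ^ A ≤ ρ ^ (A / 2) := by
      calc q.2 ^ A = (q.2 ^ 2) ^ (A / 2) := by
            rw [← Real.rpow_natCast, ← Real.rpow_mul hz]
            congr 1
            push_cast
            ring
        _ ≤ ρ ^ (A / 2) := by
            refine Real.rpow_le_rpow (by positivity) ?_ (by positivity)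
            nlinarith [sq_nonneg ‖q.1 - x₀‖]
    have h2 : ε ≤ ρ ^ (-κ) := by
      calc ε ≤ q.2 ^ A * ρ ^ (-μ) := hq
        _ ≤ ρ ^ (A / 2) * ρ ^ (-μ) := by gcongr
        _ = ρ ^ (-κ) := by
            rw [← Real.rpow_add hρ0]
            congr 1
            rw [hκ]
            ring
    have h3 : ρ ^ κ ≤ ε⁻¹ := by
      rw [Real.rpow_neg hρ0.le] at h2
      exact (le_inv_comm₀ hε (by positivity)).mp h2
    have h4 : ρ ≤ R := by
      calc ρ = (ρ ^ κ) ^ (1 / κ) := by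
            rw [← Real.rpow_mul hρ0.le, mul_one_div_cancel hκ0.ne', Real.rpow_one]
        _ ≤ R := Real.rpow_le_rpow (by positivity) h3 (by positivity)
    rw [Metric.mem_closedBall, Prod.dist_eq, max_le_iff, dist_eq_norm, dist_eq_norm]
    constructor
    · refine Real.le_sqrt_of_sq_le ?_
      nlinarith [sq_nonneg q.2]
    · refine Real.le_sqrt_of_sq_le ?_
      simp only [sub_zero, Real.norm_eq_abs, sq_abs]
      nlinarith [sq_nonneg ‖q.1 - x₀‖]

/-- Comparison with a barrier that is a strict subsolution off the set where the supersolution is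
already known to dominate. -/
lemma le_of_barrier_subsolution {s : ℝ} {W : Euc N × ℝ → ℝ}
    (hW : ContDiffOn ℝ 2 W {q | 0 < q.2}) (hW0 : ∀ q : Euc N × ℝ, 0 < q.2 → 0 ≤ W q)
    (hLW : ∀ q : Euc N × ℝ, 0 < q.2 → CSop N s W q ≤ 0)
    (x₀ : Euc N) {A μ c δ : ℝ} (hA : 0 < A) (hAμ : A / 2 < μ) (hc : 0 < c) (hδ : 0 < δ)
    (h : ∀ q : Euc N × ℝ, 0 < q.2 → W q < δ * barrier x₀ A μ c q →
      0 < CSop N s (barrier x₀ A μ c) q) :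
    ∀ q : Euc N × ℝ, 0 < q.2 → δ * barrier x₀ A μ c q ≤ W q := by
  set F := barrier x₀ A μ c with hF
  set G : Euc N × ℝ → ℝ := fun q => W q - δ * F q with hG
  intro q₁ hq₁
  by_contra! hlt
  have hε : 0 < -G q₁ / δ := div_pos (by simp only [hG]; linarith) hδ
  set K := {q : Euc N × ℝ | 0 ≤ q.2 ∧ -G q₁ / δ ≤ F q} with hK
  have hKc : IsCompact K := isCompact_barrier_superlevel x₀ hA hAμ hc hε
  have hKpos : ∀ q ∈ K, 0 < q.2 := by
    rintro q ⟨h1, h2⟩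
    refine lt_of_le_of_ne h1 fun h0 => ?_
    have : F q = 0 := by simp [hF, barrier, ← h0, Real.zero_rpow hA.ne']
    linarith
  have hGc : ContinuousOn G K := fun q hq =>
    (((contDiffAt_of_pos hW (hKpos q hq)).continuousAt).sub
      ((contDiffAt_barrier x₀ A μ hc.le (hKpos q hq)).continuousAt.const_mul
        δ)).continuousWithinAt
  have hq₁K : q₁ ∈ K := by
    refine ⟨hq₁.le, ?_⟩
    rw [div_le_iff₀ hδ]
    have := hW0 q₁ hq₁
    simp only [hG]
    linarith
  obtain ⟨p, hpK, hp⟩ := hKc.exists_isMinOn ⟨q₁, hq₁K⟩ hGc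
  have hp0 := hKpos p hpK
  have hpq : G p ≤ G q₁ := hp hq₁K
  have hloc : IsLocalMin G p := by
    filter_upwards [(isOpen_lt continuous_const continuous_snd).mem_nhds hp0] with q hq
    by_cases hqK : q ∈ K
    · exact hp hqK
    · have : F q < -G q₁ / δ := by
        by_contra! hcon
        exact hqK ⟨le_of_lt hq, hcon⟩
      rw [lt_div_iff₀ hδ] at this
      have := hW0 q hq
      refine hpq.trans ?_
      change _ ≤ W q - δ * F q
      linarith
  have hWp := contDiffAt_of_pos hW hp0
  have hFp := contDiffAt_barrier x₀ A μ hc.le hp0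
  have h1 : 0 ≤ CSop N s G p := hloc.CSop_nonneg (hWp.sub (contDiffAt_const.mul hFp)) hp0
  rw [hG, CSop_sub_const_mul hWp hFp] at h1
  have h2 : 0 < CSop N s F p := h p hp0 (by
    have : W p - δ * F p ≤ W q₁ - δ * F q₁ := hpq
    linarith)
  have := hLW p hp0
  have := mul_pos hδ h2
  linarith

lemma exists_barrier_exponent {s e : ℝ} (hs : 0 < s) (h2s : 2 * s < N) (he : 0 < e) :
    ∃ μ A : ℝ, A = μ - ((N : ℝ) - 2 * s) / 2 ∧ 0 < μ ∧ 2 * s < A ∧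
      μ * (μ + 1) ≤ (1 + e) ^ 2 * (A * (A - 2 * s)) := by
  set M : ℝ := (N : ℝ)
  have hM0 : 0 < M := by linarith
  set μ := (2 * M * (1 + 2 * e) + 2) / (2 * e) with hμ
  have hμe : 2 * e * μ = 2 * M * (1 + 2 * e) + 2 := by rw [hμ]; field_simp
  have hμM : 0 < μ - M := by
    have : 0 < 2 * e * (μ - M) := by nlinarith
    exact pos_of_mul_pos_right this (by positivity)
  refine ⟨μ, μ - (M - 2 * s) / 2, rfl, by linarith, by linarith, ?_⟩
  have h1 : (μ - M) * (μ - M) ≤ (μ - (M - 2 * s) / 2) * (μ - (M - 2 * s) / 2 - 2 * s) :=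
    mul_le_mul (by linarith) (by linarith) hμM.le (by linarith)
  calc μ * (μ + 1) ≤ (1 + 2 * e) * ((μ - M) * (μ - M)) := by
        have h2 : 2 * e * μ * μ = (2 * M * (1 + 2 * e) + 2) * μ := by rw [hμe]
        have h3 : 0 ≤ (1 + 2 * e) * M ^ 2 := by positivity
        linarith
    _ ≤ (1 + e) ^ 2 * ((μ - M) * (μ - M)) := by
        have := mul_pos hμM hμM
        gcongr
        nlinarith
    _ ≤ _ := by gcongr

/-- Strong maximum principle in the open half-space. -/
lemma pos_of_supersolution {s : ℝ} (hs : 0 < s) (h2s : 2 * s < N) {W : Euc N × ℝ → ℝ}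
    (hW : ContDiffOn ℝ 2 W {q | 0 < q.2}) (hW0 : ∀ q : Euc N × ℝ, 0 < q.2 → 0 ≤ W q)
    (hLW : ∀ q : Euc N × ℝ, 0 < q.2 → CSop N s W q ≤ 0)
    {q₀ : Euc N × ℝ} (hq₀ : 0 < q₀.2) (hWq₀ : 0 < W q₀) :
    ∀ q : Euc N × ℝ, 0 < q.2 → 0 < W q := by
  obtain ⟨R, hR, hball⟩ := Metric.eventually_nhds_iff.mp
    ((contDiffAt_of_pos hW hq₀).continuousAt.eventually (lt_mem_nhds (half_lt_self hWq₀)))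
  obtain ⟨x₀, y⟩ := q₀
  simp only at hq₀
  obtain ⟨e, he0, he1, heR⟩ : ∃ e : ℝ, 0 < e ∧ e ≤ 1 / 2 ∧ 6 * e * y ^ 2 < R ^ 2 := by
    refine ⟨min (1 / 2) (R ^ 2 / (12 * y ^ 2)), by positivity, min_le_left _ _, ?_⟩
    have h1 : min (1 / 2) (R ^ 2 / (12 * y ^ 2)) ≤ R ^ 2 / (12 * y ^ 2) := min_le_right _ _
    rw [le_div_iff₀ (by positivity)] at h1
    nlinarith [sq_pos_of_pos hR]
  obtain ⟨μ, A, hA, hμ0, hA2, hμA⟩ := exists_barrier_exponent hs h2s he0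
  have hy2 : 0 < y ^ 2 := by positivity
  set C := (3 * y) ^ A * (y ^ 2) ^ (-μ) with hC
  have hC0 : 0 < C := by positivity
  set δ := W (x₀, y) / 2 / C with hδ
  have hδ0 : 0 < δ := by positivity
  have key := le_of_barrier_subsolution hW hW0 hLW x₀ (A := A) (μ := μ) (c := y ^ 2) (δ := δ)
    (by linarith) (by linarith) hy2 hδ0 ?_
  · intro q hq
    exact (mul_pos hδ0 (barrier_pos x₀ A μ hy2.le hq)).trans_le (key q hq)
  · intro q hq hlt
    set ρ := ‖q.1 - x₀‖ ^ 2 + q.2 ^ 2 + y ^ 2 with hρ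
    have hρ0 : 0 < ρ := by positivity
    have hfar : (1 + e) * (2 * q.2 * y) < ρ := by
      by_contra! hnear
      have hd : ‖q.1 - x₀‖ ^ 2 + (q.2 - y) ^ 2 ≤ 2 * e * (q.2 * y) := by
        rw [hρ] at hnear
        nlinarith
      have hqy : 0 < q.2 * y := by positivity
      have hz3 : q.2 ≤ 3 * y := by
        by_contra! hcon
        nlinarith [sq_nonneg ‖q.1 - x₀‖]
      have hd2 : ‖q.1 - x₀‖ ^ 2 + (q.2 - y) ^ 2 < R ^ 2 := by
        have : e * (q.2 * y) ≤ e * (3 * y * y) := by gcongr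
        nlinarith
      have hWq : W (x₀, y) / 2 < W q := by
        refine hball ?_
        rw [Prod.dist_eq, max_lt_iff, dist_eq_norm, dist_eq_norm, Real.norm_eq_abs]
        constructor
        · exact lt_of_pow_lt_pow_left₀ 2 hR.le (by nlinarith [sq_nonneg (q.2 - y)])
        · refine lt_of_pow_lt_pow_left₀ 2 hR.le ?_
          simp only [sq_abs]
          nlinarith [sq_nonneg ‖q.1 - x₀‖]
      have hFC : barrier x₀ A μ (y ^ 2) q ≤ C := by
        refine mul_le_mul (Real.rpow_le_rpow hq.le hz3 (by linarith)) ?_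
          (by positivity) (by positivity)
        exact Real.rpow_le_rpow_of_nonpos hy2 (by nlinarith [sq_nonneg ‖q.1 - x₀‖, sq_nonneg q.2])
          (by linarith)
      have : δ * barrier x₀ A μ (y ^ 2) q ≤ W (x₀, y) / 2 := by
        calc δ * barrier x₀ A μ (y ^ 2) q ≤ δ * C := by gcongr
          _ = W (x₀, y) / 2 := by rw [hδ]; field_simp
      linarith
    rw [CSop_barrier s x₀ A μ hy2.le hq hρ]
    have hmid : 2 * μ - N + 2 * s - 2 * A = 0 := by rw [hA]; ring
    have hAA : 0 < A * (A - 2 * s) := mul_pos (by linarith) (by linarith)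
    have hsq : ((1 + e) * (2 * q.2 * y)) ^ 2 < ρ ^ 2 := by
      have : 0 < (1 + e) * (2 * q.2 * y) := by positivity
      gcongr
    refine mul_pos (mul_pos (by positivity) (barrier_pos x₀ A μ hy2.le hq)) ?_
    rw [hmid, mul_zero, zero_div, add_zero, sub_pos, div_lt_div_iff₀ (by positivity)
      (by positivity)]
    calc 4 * μ * (μ + 1) * y ^ 2 * q.2 ^ 2 = 4 * y ^ 2 * q.2 ^ 2 * (μ * (μ + 1)) := by ring
      _ ≤ 4 * y ^ 2 * q.2 ^ 2 * ((1 + e) ^ 2 * (A * (A - 2 * s))) := by gcongr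
      _ = A * (A - 2 * s) * ((1 + e) * (2 * q.2 * y)) ^ 2 := by ring
      _ < A * (A - 2 * s) * ρ ^ 2 := by gcongr

end MaximumPrinciple

section BoundaryPoint

variable {N : ℕ}

/-- Hopf-type barrier at the boundary point `(x₀, 0)`. -/
noncomputable def hopfBarrier (s k : ℝ) (x₀ : Euc N) (q : Euc N × ℝ) : ℝ :=
  (barrier x₀ (2 * s) 0 0 q - k * barrier x₀ (2 * s) (-1) 0 q)
    - (-1) * barrier x₀ (2 * s + 1) 0 0 q

lemma hopfBarrier_eq {s : ℝ} (hs : 0 < s) (k : ℝ) (x₀ : Euc N) {q : Euc N × ℝ} (hq : 0 ≤ q.2) :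
    hopfBarrier s k x₀ q =
      q.2 ^ (2 * s) * (1 + q.2 - k * (‖q.1 - x₀‖ ^ 2 + q.2 ^ 2)) := by
  simp only [hopfBarrier, barrier, neg_zero, Real.rpow_zero, neg_neg, Real.rpow_one,
    Real.rpow_add_one' hq (by positivity : 2 * s + 1 ≠ 0)]
  ring

lemma contDiffAt_hopfBarrier (s k : ℝ) (x₀ : Euc N) {q : Euc N × ℝ} (hq : 0 < q.2) :
    ContDiffAt ℝ 2 (hopfBarrier s k x₀) q :=
  ((contDiffAt_barrier x₀ _ _ le_rfl hq).sub
    (contDiffAt_const.mul (contDiffAt_barrier x₀ _ _ le_rfl hq))).sub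
    (contDiffAt_const.mul (contDiffAt_barrier x₀ _ _ le_rfl hq))

lemma CSop_hopfBarrier_pos {s k : ℝ} (x₀ : Euc N) {q : Euc N × ℝ}
    (hq : 0 < q.2) (hqk : 2 * k * (N + 2 + 2 * s) * q.2 < 2 * s + 1) :
    0 < CSop N s (hopfBarrier s k x₀) q := by
  have h1 := contDiffAt_barrier x₀ (2 * s) 0 le_rfl hq
  have h2 := contDiffAt_barrier x₀ (2 * s) (-1) le_rfl hq
  have h3 := contDiffAt_barrier x₀ (2 * s + 1) 0 le_rfl hq
  have hρ : 0 < ‖q.1 - x₀‖ ^ 2 + q.2 ^ 2 + 0 := barrier_base_pos x₀ le_rfl hq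
  unfold hopfBarrier
  rw [CSop_sub_const_mul (h1.sub (contDiffAt_const.mul h2)) h3, CSop_sub_const_mul h1 h2,
    CSop_barrier s x₀ _ _ le_rfl hq rfl, CSop_barrier s x₀ _ _ le_rfl hq rfl,
    CSop_barrier s x₀ _ _ le_rfl hq rfl]
  have key : 0 < q.2 ^ (1 - 2 * s) * q.2 ^ (2 * s) *
      (((2 * s + 1) - 2 * k * (N + 2 + 2 * s) * q.2) / q.2) := by
    have := sub_pos.mpr hqk
    positivity
  refine key.trans_eq ?_
  simp only [barrier, neg_zero, Real.rpow_zero, neg_neg, Real.rpow_one, Real.rpow_add_one hq.ne']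
  field_simp
  ring

lemma hopf_lower_bound {s : ℝ} (hs : 0 < s) {W : Euc N × ℝ → ℝ}
    (hW : ContDiffOn ℝ 2 W {q | 0 < q.2})
    (hWc : ContinuousOn W ({q : Euc N × ℝ | 0 ≤ q.2} \ {0}))
    (hW0 : ∀ q : Euc N × ℝ, 0 ≤ q.2 → q ≠ 0 → 0 ≤ W q)
    (hLW : ∀ q : Euc N × ℝ, 0 < q.2 → CSop N s W q ≤ 0)
    (hpos : ∀ q : Euc N × ℝ, 0 < q.2 → 0 < W q) {x₀ : Euc N} (hx₀ : x₀ ≠ 0) :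
    ∃ δ > 0, ∃ η > 0, ∀ z : ℝ, 0 < z → z ≤ η → δ * z ^ (2 * s) ≤ W (x₀, z) := by
  have hn : 0 < ‖x₀‖ := norm_pos_iff.mpr hx₀
  set k := 8 / ‖x₀‖ ^ 2 with hk
  have hk0 : 0 < k := by positivity
  have hkn : k * (‖x₀‖ / 2) ^ 2 = 2 := by rw [hk]; field_simp; norm_num
  set a := 2 * k * (N + 2 + 2 * s) with ha
  have ha0 : 0 < a := by positivity
  obtain ⟨η, hη0, hη1, hηk, hηa⟩ : ∃ η : ℝ, 0 < η ∧ η ≤ 1 ∧ k * η ≤ 1 ∧ a * η < 2 * s + 1 := by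
    refine ⟨min 1 (min (1 / k) (s / a)), by positivity, min_le_left _ _, ?_, ?_⟩
    · rw [← le_div_iff₀' hk0]
      exact (min_le_right _ _).trans (min_le_left _ _)
    · rw [← lt_div_iff₀' ha0]
      refine ((min_le_right _ _).trans (min_le_right _ _)).trans_lt ?_
      gcongr
      linarith
  set B := closedBall x₀ (‖x₀‖ / 2) with hB
  have hDne : ∀ q ∈ B ×ˢ Icc (0 : ℝ) η, q ≠ 0 := by
    rintro q ⟨hq, -⟩ rfl
    rw [hB, mem_closedBall, Prod.fst_zero, dist_zero_left] at hq
    linarith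
  have hDW : ContinuousOn W (B ×ˢ Icc (0 : ℝ) η) :=
    hWc.mono fun q hq => ⟨hq.2.1, hDne q hq⟩
  have hBc : IsCompact B := isCompact_closedBall _ _
  have hx₀B : x₀ ∈ B := mem_closedBall_self (by positivity)
  obtain ⟨t, ht, htmin⟩ := (hBc.prod (isCompact_singleton (x := η))).exists_isMinOn
    ⟨(x₀, η), hx₀B, rfl⟩ (hDW.mono (prod_mono_right (by simpa using hη0.le)))
  have ht0 : 0 < W t := hpos t (by rw [show t.2 = η from ht.2]; exact hη0)
  set δ := W t / 2 with hδ
  have hδ0 : 0 < δ := by positivity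
  set V := hopfBarrier s k x₀ with hV
  have hVc : ContinuousOn V (B ×ˢ Icc (0 : ℝ) η) := by
    have h1 : Continuous fun q : Euc N × ℝ => q.2 ^ (2 * s) :=
      continuous_snd.rpow_const fun _ => Or.inr (by positivity)
    have h2 : Continuous fun q : Euc N × ℝ =>
        1 + q.2 - k * (‖q.1 - x₀‖ ^ 2 + q.2 ^ 2) := by fun_prop
    exact (h1.mul h2).continuousOn.congr fun q hq => hopfBarrier_eq hs k x₀ hq.2.1
  set G : Euc N × ℝ → ℝ := fun q => W q - δ * V q with hG
  have hDc : IsCompact (B ×ˢ Icc (0 : ℝ) η) := hBc.prod isCompact_Icc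
  obtain ⟨p, hpD, hp⟩ := hDc.exists_isMinOn ⟨(x₀, η), hx₀B, hη0.le, le_rfl⟩
    (hDW.sub (hVc.const_mul δ))
  have hGp : 0 ≤ G p := by
    by_contra! hneg
    have hWV : W p < δ * V p := by simp only [hG] at hneg; linarith
    obtain ⟨hpB, hpz0, hpzη⟩ := hpD
    have hWp : 0 ≤ W p := hW0 p hpz0 (hDne p ⟨hpB, hpz0, hpzη⟩)
    have hVpos : 0 < V p := pos_of_mul_pos_right (hWp.trans_lt hWV) hδ0.le
    have hVeq : V p = _ := hopfBarrier_eq hs k x₀ hpz0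
    have hz : 0 < p.2 := by
      refine lt_of_le_of_ne hpz0 fun h0 => ?_
      rw [hVeq, ← h0, Real.zero_rpow (by positivity), zero_mul] at hVpos
      exact hVpos.false
    have hside : ‖p.1 - x₀‖ < ‖x₀‖ / 2 := by
      refine lt_of_le_of_ne (by simpa [hB, mem_closedBall, dist_eq_norm] using hpB) fun h => ?_
      rw [hVeq, h] at hVpos
      have h1 := pos_of_mul_pos_right hVpos (by positivity)
      nlinarith [sq_nonneg p.2]
    have htop : p.2 < η := by
      refine lt_of_le_of_ne hpzη fun h => ?_
      have h1 : W t ≤ W p := htmin ⟨hpB, h⟩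
      have h2 : V p ≤ 1 * 2 := by
        rw [hVeq]
        refine mul_le_mul_of_nonneg (Real.rpow_le_one hpz0 (by linarith) (by positivity)) ?_
          (by positivity) (by norm_num)
        have : 0 ≤ k * (‖p.1 - x₀‖ ^ 2 + p.2 ^ 2) := by positivity
        linarith
      nlinarith
    have hloc : IsLocalMin G p := by
      have hmem : B ×ˢ Icc (0 : ℝ) η ∈ 𝓝 p := by
        refine prod_mem_nhds ?_ (Icc_mem_nhds hz htop)
        refine mem_of_superset (isOpen_ball.mem_nhds ?_) ball_subset_closedBall
        simpa [mem_ball, dist_eq_norm] using hside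
      exact hp.isLocalMin hmem
    have hWp2 := contDiffAt_of_pos hW hz
    have hVp2 := contDiffAt_hopfBarrier s k x₀ hz
    have h1 : 0 ≤ CSop N s G p :=
      hloc.CSop_nonneg (hWp2.sub (contDiffAt_const.mul hVp2)) hz
    rw [hG, CSop_sub_const_mul hWp2 hVp2] at h1
    have h2 : 0 < CSop N s V p := CSop_hopfBarrier_pos x₀ hz (by
      change a * p.2 < _
      nlinarith)
    have := hLW p hz
    have := mul_pos hδ0 h2
    linarith
  refine ⟨δ, hδ0, η, hη0, fun z hz0 hzη => ?_⟩
  have h1 : G p ≤ G (x₀, z) := hp (show (x₀, z) ∈ B ×ˢ Icc (0 : ℝ) η from ⟨hx₀B, hz0.le, hzη⟩)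
  have h2 : 0 ≤ W (x₀, z) - δ * V (x₀, z) := hGp.trans h1
  have h3 : z ^ (2 * s) ≤ V (x₀, z) := by
    rw [hV, hopfBarrier_eq hs k x₀ (q := (x₀, z)) hz0.le]
    refine le_mul_of_one_le_right (by positivity) ?_
    have : k * z ≤ 1 := (by gcongr : k * z ≤ k * η).trans hηk
    simp only [sub_self, norm_zero]
    nlinarith
  have := mul_le_mul_of_nonneg_left h3 hδ0.le
  linarith

lemma weighted_deriv_limit_pos {s : ℝ} (hs : 0 < s) {w g : ℝ → ℝ}
    (hc : ContinuousOn w (Ici 0)) (h0 : w 0 = 0) (hd : ∀ z > 0, HasDerivAt w (g z) z)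
    {δ η : ℝ} (hδ : 0 < δ) (hη : 0 < η)
    (hle : ∀ z : ℝ, 0 < z → z ≤ η → δ * z ^ (2 * s) ≤ w z) {l : ℝ}
    (hl : Tendsto (fun z => z ^ (1 - 2 * s) * g z) (𝓝[>] 0) (𝓝 l)) : 0 < l := by
  by_contra! hl0
  obtain ⟨r, hr0, hr⟩ := mem_nhdsGT_iff_exists_Ioo_subset.mp
    (hl.eventually (gt_mem_nhds (hl0.trans_lt (mul_pos hδ hs))))
  have hr0 : 0 < r := hr0
  set t := min η r with ht
  have ht0 : 0 < t := by positivity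
  set ψ : ℝ → ℝ := fun z => w z - δ / 2 * z ^ (2 * s) with hψ
  have hψd : ∀ z > 0, HasDerivAt ψ (g z - δ / 2 * (2 * s * z ^ (2 * s - 1))) z := fun z hz =>
    (hd z hz).sub ((Real.hasDerivAt_rpow_const (Or.inl hz.ne')).const_mul _)
  have hanti : AntitoneOn ψ (Icc 0 t) := by
    refine antitoneOn_of_deriv_nonpos (convex_Icc 0 t) ?_ ?_ ?_
    · exact (hc.mono Icc_subset_Ici_self).sub
        (continuousOn_const.mul (continuousOn_id.rpow_const fun _ _ => Or.inr (by positivity)))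
    · rw [interior_Icc]
      exact fun z hz => (hψd z hz.1).differentiableAt.differentiableWithinAt
    · rw [interior_Icc]
      rintro z ⟨hz, hzt⟩
      rw [(hψd z hz).deriv]
      have h1 : z ^ (1 - 2 * s) * g z < δ * s := hr ⟨hz, hzt.trans_le (min_le_right _ _)⟩
      have h2 : z ^ (1 - 2 * s) * z ^ (2 * s - 1) = 1 := by
        rw [← Real.rpow_add hz]
        simp
      have h3 : 0 < z ^ (1 - 2 * s) := by positivity
      have h4 : z ^ (1 - 2 * s) * (g z - δ / 2 * (2 * s * z ^ (2 * s - 1))) < 0 := by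
        linear_combination h1 - δ * s * h2
      exact (neg_of_mul_neg_right h4 h3.le).le
  have h1 : ψ t ≤ ψ 0 := hanti ⟨le_rfl, ht0.le⟩ ⟨ht0.le, le_rfl⟩ ht0.le
  have h2 := hle t ht0 (min_le_left _ _)
  have h3 : 0 < δ * t ^ (2 * s) := by positivity
  simp only [hψ, h0, Real.zero_rpow (by positivity : 2 * s ≠ 0)] at h1
  linarith

lemma continuousOn_vertical {W : Euc N × ℝ → ℝ}
    (hWc : ContinuousOn W ({q : Euc N × ℝ | 0 ≤ q.2} \ {0})) {q : Euc N × ℝ} (hq : 0 ≤ q.2)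
    (hq0 : q ≠ 0) : ContinuousOn (fun t : ℝ => W (q.1, q.2 + t)) (Ici 0) := by
  refine hWc.comp (f := fun t : ℝ => (q.1, q.2 + t)) (by fun_prop) fun t ht => ?_
  have ht : 0 ≤ t := ht
  refine ⟨by simp only [mem_ofPred_eq]; linarith, fun h => hq0 ?_⟩
  simp only [mem_singleton_iff, Prod.mk_eq_zero] at h
  exact Prod.ext h.1 (by simp only [Prod.snd_zero]; linarith)

lemma eq_zero_of_eq_zero_on_interior {W : Euc N × ℝ → ℝ}
    (hWc : ContinuousOn W ({q : Euc N × ℝ | 0 ≤ q.2} \ {0}))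
    (h : ∀ q : Euc N × ℝ, 0 < q.2 → W q = 0) {q : Euc N × ℝ} (hq : 0 ≤ q.2) (hq0 : q ≠ 0) :
    W q = 0 := by
  have h1 : Tendsto (fun t : ℝ => W (q.1, q.2 + t)) (𝓝[>] 0) (𝓝 (W (q.1, q.2 + 0))) :=
    (continuousOn_vertical hWc hq hq0 0 self_mem_Ici).mono Ioi_subset_Ici_self
  have h2 : Tendsto (fun t : ℝ => W (q.1, q.2 + t)) (𝓝[>] 0) (𝓝 0) := by
    refine tendsto_const_nhds.congr' ?_
    filter_upwards [self_mem_nhdsWithin] with t ht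
    exact (h _ (add_pos_of_nonneg_of_pos hq ht)).symm
  simpa using tendsto_nhds_unique h1 h2

lemma tendsto_weighted_fderiv_radial {s : ℝ} (hs : s < 1) (μ : ℝ) {x : Euc N} (hx : x ≠ 0) :
    Tendsto (fun z : ℝ => z ^ (1 - 2 * s) *
      fderiv ℝ (barrier (0 : Euc N) 0 μ 0) (x, z) ((0 : Euc N), (1 : ℝ))) (𝓝[>] 0) (𝓝 0) := by
  have hn : 0 < ‖x‖ := norm_pos_iff.mpr hx
  set f : ℝ → ℝ := fun z =>
    z ^ (2 - 2 * s) * ((‖x‖ ^ 2 + z ^ 2) ^ (-μ) * (-(2 * μ) / (‖x‖ ^ 2 + z ^ 2))) with hf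
  have hfc : Continuous f := by
    have h1 : Continuous fun z : ℝ => z ^ (2 - 2 * s) :=
      continuous_id.rpow_const fun _ => Or.inr (by linarith)
    have h2 : Continuous fun z : ℝ => ‖x‖ ^ 2 + z ^ 2 := by fun_prop
    have h3 : ∀ z : ℝ, ‖x‖ ^ 2 + z ^ 2 ≠ 0 := fun z => by positivity
    exact h1.mul ((h2.rpow_const fun z => Or.inl (h3 z)).mul (continuous_const.div h2 h3))
  have hf0 : f 0 = 0 := by
    simp only [hf]
    rw [Real.zero_rpow (by linarith), zero_mul]
  refine ((hf0 ▸ hfc.tendsto 0).mono_left nhdsWithin_le_nhds).congr' ?_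
  filter_upwards [self_mem_nhdsWithin] with z hz
  have hz : 0 < z := hz
  rw [(barrier_derivs (0 : Euc N) 0 μ le_rfl (q := (x, z)) hz (v := ((0 : Euc N), (1 : ℝ)))
    (by simp) rfl (b := z) (by simp)).1]
  have h2 : z ^ (2 - 2 * s) = z ^ (1 - 2 * s) * z := by
    rw [← Real.rpow_add_one hz.ne']
    congr 1
    ring
  simp only [hf, h2, sub_zero, add_zero, Real.rpow_zero]
  ring

end BoundaryPoint

section Homogeneous

variable {N : ℕ}

lemma barrier_radial (μ : ℝ) (q : Euc N × ℝ) :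
    barrier (0 : Euc N) 0 μ 0 q = (‖q.1‖ ^ 2 + q.2 ^ 2) ^ (-μ) := by
  simp [barrier]

lemma norm_sq_add_sq_pos {q : Euc N × ℝ} (hq : q ≠ 0) : 0 < ‖q.1‖ ^ 2 + q.2 ^ 2 := by
  rcases eq_or_ne q.1 0 with h | h
  · have : q.2 ≠ 0 := fun h2 => hq (Prod.ext h h2)
    positivity
  · have := norm_pos_iff.mpr h
    positivity

lemma continuousOn_barrier_radial (μ : ℝ) :
    ContinuousOn (barrier (0 : Euc N) 0 μ 0) ({q : Euc N × ℝ | 0 ≤ q.2} \ {0}) := by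
  have h : Continuous fun q : Euc N × ℝ => ‖q.1‖ ^ 2 + q.2 ^ 2 := by fun_prop
  refine (h.continuousOn.rpow_const (p := -μ) fun q hq => Or.inl ?_).congr
    fun q _ => barrier_radial μ q
  exact (norm_sq_add_sq_pos hq.2).ne'

lemma isCompact_half_sphere : IsCompact {q : Euc N × ℝ | 0 ≤ q.2 ∧ ‖q.1‖ ^ 2 + q.2 ^ 2 = 1} := by
  refine (isCompact_closedBall (0 : Euc N × ℝ) 1).of_isClosed_subset ?_ ?_
  · exact (isClosed_le continuous_const continuous_snd).inter
      (isClosed_eq (by fun_prop) continuous_const)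
  · rintro q ⟨-, hq⟩
    rw [mem_closedBall, dist_zero_right, Prod.norm_def, max_le_iff]
    constructor
    · exact (sq_le_one_iff₀ (norm_nonneg _)).mp (by nlinarith [sq_nonneg q.2])
    · exact (sq_le_one_iff₀ (norm_nonneg _)).mp
        (by rw [Real.norm_eq_abs, sq_abs]; nlinarith [sq_nonneg ‖q.1‖])

/-- A homogeneous function dominates its minimum over the half-sphere, extended radially. -/
lemma radial_le_of_homogeneous {u : Euc N × ℝ → ℝ} {α m : ℝ}
    (hh : ∀ l : ℝ, 0 < l → ∀ q : Euc N × ℝ, u (l • q.1, l * q.2) = l ^ (-α) * u q)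
    (hm : ∀ q : Euc N × ℝ, 0 ≤ q.2 → ‖q.1‖ ^ 2 + q.2 ^ 2 = 1 → m ≤ u q)
    {q : Euc N × ℝ} (hq : 0 ≤ q.2) (hq0 : q ≠ 0) :
    m * barrier (0 : Euc N) 0 (α / 2) 0 q ≤ u q := by
  have hρ := norm_sq_add_sq_pos hq0
  set r := √(‖q.1‖ ^ 2 + q.2 ^ 2) with hr
  have hr0 : 0 < r := Real.sqrt_pos.mpr hρ
  have hr2 : r ^ 2 = ‖q.1‖ ^ 2 + q.2 ^ 2 := Real.sq_sqrt hρ.le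
  have hR : barrier (0 : Euc N) 0 (α / 2) 0 q = r ^ (-α) := by
    rw [barrier_radial, ← hr2, ← Real.rpow_natCast, ← Real.rpow_mul hr0.le]
    congr 1
    push_cast
    ring
  have h1 := hh r hr0 (r⁻¹ • q.1, r⁻¹ * q.2)
  simp only [smul_inv_smul₀ hr0.ne', mul_inv_cancel_left₀ hr0.ne', Prod.mk.eta] at h1
  rw [h1, hR, mul_comm]
  refine mul_le_mul_of_nonneg_left (hm _ (by positivity) ?_) (by positivity)
  simp only [norm_smul, norm_inv, Real.norm_eq_abs, abs_of_pos hr0]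
  field_simp
  linarith

end Homogeneous

/-- Theorem C, part 1: if `1 < p ≤ N/(N-2s)` then `E₋₁⁺ = {0}`. -/
theorem stmt6 (N : ℕ) (hN : 1 ≤ N) (s p : ℝ) (hs : s ∈ Set.Ioo (0:ℝ) 1)
    (h2s : 2*s < N) (hp1 : 1 < p) (hp2 : p ≤ (N:ℝ)/((N:ℝ) - 2*s))
    (u : Euc N × ℝ → ℝ) (hu : u ∈ SelfSimPos N s p (-1)) :
    ∀ q : Euc N × ℝ, 0 ≤ q.2 → q ≠ 0 → u q = 0 := by
  obtain ⟨⟨huc, huC, huh, huL, huB⟩, hu0⟩ := hu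
  obtain ⟨hs0, hs1⟩ := hs
  set α := 2 * s / (p - 1) with hα
  have hp0 : 0 < p - 1 := by linarith
  have hD : 0 < (N : ℝ) - 2 * s := by linarith
  have hα0 : 0 < α := by positivity
  have hαN : (N : ℝ) - 2 * s ≤ α := by
    rw [le_div_iff₀ hD] at hp2
    rw [hα, le_div_iff₀ hp0]
    linarith
  have huh : ∀ l : ℝ, 0 < l → ∀ q : Euc N × ℝ, u (l • q.1, l * q.2) = l ^ (-α) * u q := by
    intro l hl q
    rw [huh l hl q, hα, neg_div]
  have hSne : ∀ q : Euc N × ℝ, ‖q.1‖ ^ 2 + q.2 ^ 2 = 1 → q ≠ 0 := by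
    rintro q hq rfl
    simp at hq
  obtain ⟨t, ⟨ht0, ht1⟩, htmin⟩ := (isCompact_half_sphere (N := N)).exists_isMinOn
    ⟨(0, 1), by simp⟩ (huc.mono fun q hq => ⟨hq.1, hSne q hq.2⟩)
  set m := u t with hm
  have hm0 : 0 ≤ m := hu0 t ht0
  set F := barrier (0 : Euc N) 0 (α / 2) 0 with hF
  set W : Euc N × ℝ → ℝ := fun q => u q - m * F q with hWdef
  have hFC : ∀ q : Euc N × ℝ, 0 < q.2 → ContDiffAt ℝ 2 F q := fun q hq =>
    contDiffAt_barrier 0 _ _ le_rfl hq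
  have hWC : ContDiffOn ℝ 2 W {q | 0 < q.2} := fun q hq =>
    ((contDiffAt_of_pos huC hq).sub (contDiffAt_const.mul (hFC q hq))).contDiffWithinAt
  have hWc : ContinuousOn W ({q : Euc N × ℝ | 0 ≤ q.2} \ {0}) :=
    huc.sub ((continuousOn_barrier_radial _).const_mul m)
  have hW0 : ∀ q : Euc N × ℝ, 0 ≤ q.2 → q ≠ 0 → 0 ≤ W q := fun q hq hq0 =>
    sub_nonneg.mpr (radial_le_of_homogeneous huh (fun q h1 h2 => htmin ⟨h1, h2⟩) hq hq0)
  have hne : ∀ q : Euc N × ℝ, 0 < q.2 → q ≠ 0 := by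
    rintro q hq rfl
    exact lt_irrefl _ hq
  have hLW : ∀ q : Euc N × ℝ, 0 < q.2 → CSop N s W q ≤ 0 := by
    intro q hq
    rw [hWdef, CSop_sub_const_mul (contDiffAt_of_pos huC hq) (hFC q hq), huL q hq, hF,
      CSop_barrier s 0 _ _ le_rfl hq rfl, zero_sub, neg_nonpos]
    have h1 : 0 ≤ 2 * (α / 2) - N + 2 * s - 2 * 0 := by linarith
    have h2 := barrier_pos (0 : Euc N) 0 (α / 2) le_rfl hq
    have h3 := barrier_base_pos (0 : Euc N) le_rfl hq
    simp only [zero_mul, mul_zero, zero_div, zero_add, sub_zero] at h1 ⊢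
    positivity
  have hflux : ∀ x : Euc N, x ≠ 0 →
      Tendsto (fun z : ℝ => z ^ (1 - 2 * s) * fderiv ℝ W (x, z) ((0 : Euc N), (1 : ℝ)))
        (𝓝[>] 0) (𝓝 (-1 * |u (x, 0)| ^ (p - 1) * u (x, 0) - m * 0)) := by
    intro x hx
    refine ((huB x hx).sub ((tendsto_weighted_fderiv_radial hs1 (α / 2) hx).const_mul m)).congr' ?_
    filter_upwards [self_mem_nhdsWithin] with z hz
    have hz : 0 < (x, z).2 := hz
    rw [hWdef, fderiv_sub_const_mul_apply ((contDiffAt_of_pos huC hz).differentiableAt (by simp))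
      ((hFC _ hz).differentiableAt (by simp))]
    ring
  by_cases hex : ∃ q₀ : Euc N × ℝ, 0 < q₀.2 ∧ 0 < W q₀
  · obtain ⟨q₀, hq₀, hWq₀⟩ := hex
    have hWpos := pos_of_supersolution hs0 h2s hWC (fun q hq => hW0 q hq.le (hne q hq)) hLW hq₀ hWq₀
    have hWt : W t = 0 := by
      simp only [hWdef, hF, barrier_radial, ht1, Real.one_rpow, mul_one, hm, sub_self]
    have ht2 : t.2 = 0 := le_antisymm (not_lt.mp fun h => (hWpos t h).ne' hWt) ht0
    have ht : t = (t.1, 0) := Prod.ext rfl ht2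
    have hx : t.1 ≠ 0 := fun h => hSne t ht1 (Prod.ext h ht2)
    obtain ⟨δ, hδ, η, hη, hle⟩ := hopf_lower_bound hs0 hWC hWc hW0 hLW hWpos hx
    have hline : ∀ z > 0, HasDerivAt (fun z : ℝ => W (t.1, z))
        (fderiv ℝ W (t.1, z) ((0 : Euc N), (1 : ℝ))) z := by
      intro z hz
      have h1 := ((contDiffAt_of_pos hWC (q := (t.1, z)) hz).differentiableAt
        (by simp)).hasFDerivAt
      exact h1.comp_hasDerivAt z ((hasDerivAt_const z t.1).prodMk (hasDerivAt_id z))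
    have hpos := weighted_deriv_limit_pos hs0 (w := fun z => W (t.1, z))
      (by simpa [ht2] using continuousOn_vertical hWc ht0 (hSne t ht1))
      (by rw [← ht]; exact hWt) hline hδ hη hle (hflux t.1 hx)
    have h1 : 0 ≤ |u (t.1, 0)| ^ (p - 1) * u (t.1, 0) := mul_nonneg (by positivity) (hu0 _ le_rfl)
    linarith
  · push Not at hex
    have hWz : ∀ q : Euc N × ℝ, 0 < q.2 → W q = 0 := fun q hq =>
      le_antisymm (hex q hq) (hW0 q hq.le (hne q hq))
    set x : Euc N := EuclideanSpace.single ⟨0, hN⟩ (1 : ℝ) with hxdef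
    have hxn : ‖x‖ = 1 := by simp [hxdef]
    have hx : x ≠ 0 := norm_ne_zero_iff.mp (by rw [hxn]; exact one_ne_zero)
    have hlim : Tendsto
        (fun z : ℝ => z ^ (1 - 2 * s) * fderiv ℝ W (x, z) ((0 : Euc N), (1 : ℝ)))
        (𝓝[>] 0) (𝓝 0) := by
      refine tendsto_const_nhds.congr' ?_
      filter_upwards [self_mem_nhdsWithin] with z hz
      have hev : W =ᶠ[𝓝 (x, z)] fun _ => 0 := by
        filter_upwards [(isOpen_lt continuous_const continuous_snd).mem_nhds
          (show (0 : ℝ) < (x, z).2 from hz)] with q hq using hWz q hq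
      rw [hev.fderiv_eq]
      simp
    have h1 := tendsto_nhds_unique (hflux x hx) hlim
    have hWx : W (x, 0) = 0 :=
      eq_zero_of_eq_zero_on_interior hWc hWz le_rfl fun h => hx (Prod.mk_eq_zero.mp h).1
    have hux : u (x, 0) = m := by
      simp only [hWdef, hF, barrier_radial, hxn] at hWx
      norm_num at hWx
      linarith
    have hmz : m = 0 := by
      by_contra hcon
      have : 0 < m := lt_of_le_of_ne hm0 (Ne.symm hcon)
      have h2 : 0 < |m| ^ (p - 1) * m := by positivity
      rw [hux] at h1
      linarith
    intro q hq hq0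
    refine eq_zero_of_eq_zero_on_interior huc (fun q hq => ?_) hq hq0
    simpa [hWdef, hmz] using hWz q hq
end

section
/- Let N ≥ 1 be an integer, s ∈ (0,1) with N > 2s, and p > 0. Let v ∈ C²(ℝ^N∖{0}) ∩ L¹_{μ_s}(ℝ^N) satisfy (−Δ)^s v(x) + |v(x)|^{p−1} v(x) = 0 for all x ∈ ℝ^N∖{0}. Assume lim_{x→0} |x|^{N−2s} v₊(x) = 0 and that there exists τ₀ ∈ (0, 2s) with τ₀ ≥ 2s(p+1) − Np such that lim_{|x|→∞} |x|^{τ₀} v₊(x) = 0, where v₊ = max(v, 0). Then v₊ ≡ 0, i.e. v ≤ 0 on ℝ^N∖{0}. -/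
open MeasureTheory Filter Topology Set Metric Asymptotics

open EuclideanGeometry in
/-- The Jacobian determinant of the inversion in the sphere of radius `R` about the origin. -/
lemma abs_det_fderiv_inversion (N : ℕ) (R : ℝ) (y : Euc N) :
    |((R / dist y 0) ^ 2 • ((ℝ ∙ (y - 0))ᗮ.reflection : Euc N →L[ℝ] Euc N)).det|
      = (R / dist y 0) ^ (2 * N) := by
  have h : ((R / dist y 0) ^ 2 • ((ℝ ∙ (y - 0))ᗮ.reflection : Euc N →L[ℝ] Euc N)).det
      = LinearMap.det ((R / dist y 0) ^ 2 • (ℝ ∙ (y - 0))ᗮ.reflection.toLinearMap) := rfl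
  rw [h, LinearMap.det_smul, Submodule.det_reflection, abs_mul, abs_pow, abs_pow, abs_pow,
    abs_neg, abs_one, one_pow, mul_one, finrank_euclideanSpace_fin, ← abs_pow, ← abs_pow,
    ← pow_mul, abs_of_nonneg]
  exact (even_two_mul N).pow_nonneg _

/-- The kernel of the fractional Laplacian is integrable away from the diagonal. -/
lemma integrableOn_dist_rpow_inv {N : ℕ} {k ε : ℝ} (hk : (N : ℝ) < k) (hε : 0 < ε) (x : Euc N) :
    IntegrableOn (fun y : Euc N => (dist x y ^ k)⁻¹) {y | ε < dist x y} := by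
  have hk0 : 0 < k := lt_of_le_of_lt (Nat.cast_nonneg N) hk
  have hmeas : MeasurableSet {y : Euc N | ε < dist x y} :=
    (isOpen_lt continuous_const (continuous_const.dist continuous_id)).measurableSet
  have hI : Integrable (fun y : Euc N => (1 + ε⁻¹) ^ k * (1 + ‖x - y‖) ^ (-k)) := by
    have h := integrable_one_add_norm (E := Euc N) (μ := volume) (r := k) (by simpa using hk)
    exact (h.comp_sub_left x).const_mul _
  refine Integrable.mono' hI.integrableOn
    (Measurable.aestronglyMeasurable (by fun_prop)) ?_
  filter_upwards [ae_restrict_mem hmeas] with y (hy : ε < dist x y)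
  have hd : 0 < dist x y := hε.trans hy
  rw [Real.norm_of_nonneg (by positivity), ← dist_eq_norm, Real.rpow_neg (by positivity),
    ← div_eq_mul_inv, ← Real.div_rpow (by positivity) (by positivity), ← Real.inv_rpow hd.le]
  refine Real.rpow_le_rpow (by positivity) ?_ hk0.le
  rw [le_div_iff₀ (by positivity), mul_add, mul_one, inv_mul_cancel₀ hd.ne', add_comm]
  gcongr

/-- The truncated integrand of the fractional Laplacian of the fundamental solution. -/
noncomputable def fundKernel (N : ℕ) (s : ℝ) (x y : Euc N) : ℝ :=
  (‖x‖ ^ (2*s - N) - ‖y‖ ^ (2*s - N)) / dist x y ^ ((N:ℝ) + 2*s)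

open EuclideanGeometry in
/-- Inversion in the sphere through `x` centred at the origin changes the sign of the
integrand. -/
lemma fundKernel_inversion {N : ℕ} {s : ℝ} {x y : Euc N} (hx : x ≠ 0) (hy : y ≠ 0) (hxy : x ≠ y) :
    (‖x‖ / dist y 0) ^ (2 * N) * fundKernel N s x (inversion 0 ‖x‖ y) = - fundKernel N s x y := by
  have hx' : 0 < ‖x‖ := norm_pos_iff.2 hx
  have hy' : 0 < ‖y‖ := norm_pos_iff.2 hy
  have hd : 0 < dist x y := dist_pos.2 hxy
  have e1 : dist x (inversion 0 ‖x‖ y) = ‖x‖ / ‖y‖ * dist x y := by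
    have h := dist_inversion_inversion hx hy ‖x‖
    rw [inversion_of_mem_sphere (by simp)] at h
    rw [h]
    simp only [dist_zero_right]
    field_simp
  have e2 : ‖inversion 0 ‖x‖ y‖ = ‖x‖ / ‖y‖ * ‖x‖ := by
    rw [← dist_zero_right, dist_inversion_center, dist_zero_right]
    ring
  have ht : 0 < ‖x‖ / ‖y‖ := by positivity
  have e3 : ‖y‖ = ‖x‖ / (‖x‖ / ‖y‖) := by field_simp
  unfold fundKernel
  rw [e1, e2, dist_zero_right]
  generalize hT : ‖x‖ / ‖y‖ = t at *
  rw [e3, ← Real.rpow_natCast, Real.mul_rpow ht.le hx'.le, Real.mul_rpow ht.le hd.le,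
    Real.div_rpow hx'.le ht.le]
  have e4 : t ^ (((2 * N : ℕ)) : ℝ) = t ^ ((N:ℝ) + 2*s) / t ^ (2*s - N) := by
    rw [← Real.rpow_sub ht]
    congr 1
    push_cast
    ring
  rw [e4]
  have a1 : 0 < t ^ ((N:ℝ) + 2*s) := by positivity
  have a2 : 0 < t ^ (2*s - N) := by positivity
  have a3 : 0 < dist x y ^ ((N:ℝ) + 2*s) := by positivity
  field_simp
  ring

open EuclideanGeometry in
/-- The truncated integrals defining the fractional Laplacian of the fundamental solution
`‖x‖ ^ (2s - N)` converge absolutely and are nonnegative away from the origin. -/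
lemma integrableOn_fundKernel_and_nonneg {N : ℕ} (hN : 1 ≤ N) {s ε : ℝ} (hs : 0 < s)
    (h2s : 2*s < N) (hε : 0 < ε) {x : Euc N} (hx : x ≠ 0) :
    IntegrableOn (fundKernel N s x) {y | ε < dist x y} ∧
      0 ≤ ∫ y in {y | ε < dist x y}, fundKernel N s x y := by
  have hx' : 0 < ‖x‖ := norm_pos_iff.2 hx
  have : Nonempty (Fin N) := ⟨⟨0, hN⟩⟩
  set A : Set (Euc N) := {y | ε < dist x y}
  have hA : MeasurableSet A :=
    (isOpen_lt continuous_const (continuous_const.dist continuous_id)).measurableSet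
  set O : Set (Euc N) := A ∩ {y | ‖x‖ ≤ ‖y‖}
  set I : Set (Euc N) := A ∩ ({y | ‖y‖ < ‖x‖} ∩ {0}ᶜ)
  have hO : MeasurableSet O := hA.inter (measurableSet_le measurable_const measurable_norm)
  have hI : MeasurableSet I := hA.inter
    ((measurableSet_lt measurable_norm measurable_const).inter (measurableSet_singleton 0).compl)
  have hOI : Disjoint I O := by
    rw [Set.disjoint_left]
    exact fun y h1 h2 => (not_lt.2 (show ‖x‖ ≤ ‖y‖ from h2.2)) h1.2.1
  have hAe : A =ᵐ[volume] (I ∪ O : Set (Euc N)) := by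
    have h0 : ∀ᵐ y : Euc N, y ≠ 0 := by simp [ae_iff]
    filter_upwards [h0] with y hy
    apply propext
    change y ∈ A ↔ y ∈ I ∪ O
    constructor
    · intro h
      rcases lt_or_ge ‖y‖ ‖x‖ with h1 | h1
      · exact Or.inl ⟨h, h1, hy⟩
      · exact Or.inr ⟨h, h1⟩
    · rintro (h | h) <;> exact h.1
  have hmeas : Measurable (fundKernel N s x) := by
    unfold fundKernel
    fun_prop
  have hnn : ∀ y ∈ O, 0 ≤ fundKernel N s x y := by
    intro y hy
    refine div_nonneg (sub_nonneg.2 ?_) (by positivity)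
    exact Real.rpow_le_rpow_of_nonpos hx' hy.2 (by linarith)
  have hintO : IntegrableOn (fundKernel N s x) O := by
    have h := ((integrableOn_dist_rpow_inv (k := (N:ℝ) + 2*s) (by linarith) hε x).mono_set
      (inter_subset_left : O ⊆ A)).const_mul (‖x‖ ^ (2*s - N))
    refine Integrable.mono' h hmeas.aestronglyMeasurable ?_
    filter_upwards [ae_restrict_mem hO] with y hy
    rw [Real.norm_of_nonneg (hnn y hy), fundKernel, div_eq_mul_inv]
    gcongr
    linarith [Real.rpow_nonneg (norm_nonneg y) (2*s - N)]
  have hder : ∀ y ∈ I, HasFDerivWithinAt (inversion (0 : Euc N) ‖x‖)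
      ((‖x‖ / dist y 0) ^ 2 • ((ℝ ∙ (y - 0))ᗮ.reflection : Euc N →L[ℝ] Euc N)) I y :=
    fun y hy => (hasFDerivAt_inversion hy.2.2).hasFDerivWithinAt
  have hinj : InjOn (inversion (0 : Euc N) ‖x‖) I := (inversion_injective _ hx'.ne').injOn
  have hsub : inversion (0 : Euc N) ‖x‖ '' I ⊆ O := by
    rintro _ ⟨y, hy, rfl⟩
    have hy0 : y ≠ 0 := hy.2.2
    have hylt : ‖y‖ < ‖x‖ := hy.2.1
    have hyA : ε < dist x y := hy.1
    have hy' : 0 < ‖y‖ := norm_pos_iff.2 hy0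
    have h1 : 1 ≤ ‖x‖ / ‖y‖ := (one_le_div hy').2 hylt.le
    constructor
    · have h := dist_inversion_inversion hx hy0 ‖x‖
      rw [inversion_of_mem_sphere (by simp)] at h
      change ε < dist x _
      rw [h, dist_zero_right, dist_zero_right,
        show ‖x‖ ^ 2 / (‖x‖ * ‖y‖) = ‖x‖ / ‖y‖ by field_simp]
      nlinarith
    · change ‖x‖ ≤ ‖_‖
      rw [← dist_zero_right (inversion _ _ _), dist_inversion_center, dist_zero_right,
        show ‖x‖ ^ 2 / ‖y‖ = ‖x‖ / ‖y‖ * ‖x‖ by ring]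
      nlinarith
  have hcongr : ∀ y ∈ I, |((‖x‖ / dist y 0) ^ 2 •
      ((ℝ ∙ (y - 0))ᗮ.reflection : Euc N →L[ℝ] Euc N)).det| •
        fundKernel N s x (inversion 0 ‖x‖ y) = - fundKernel N s x y := by
    intro y hy
    have hxy : x ≠ y := dist_pos.1 (hε.trans hy.1)
    rw [abs_det_fderiv_inversion, smul_eq_mul, fundKernel_inversion hx hy.2.2 hxy]
  have hintI : IntegrableOn (fundKernel N s x) I := by
    have h := (integrableOn_image_iff_integrableOn_abs_det_fderiv_smul volume hI hder hinj
      (fundKernel N s x)).1 (hintO.mono_set hsub)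
    have h2 := ((integrableOn_congr_fun hcongr hI).1 h).neg
    simpa using h2
  have hval := integral_image_eq_integral_abs_det_fderiv_smul volume hI hder hinj
    (fundKernel N s x)
  rw [setIntegral_congr_fun hI hcongr, integral_neg] at hval
  refine ⟨(hintI.union hintO).congr_set_ae hAe, ?_⟩
  rw [setIntegral_congr_set hAe, setIntegral_union hOI hO hintI hintO]
  have hle := setIntegral_mono_set hintO
    ((ae_restrict_iff' hO).2 (Eventually.of_forall hnn)) hsub.eventuallyLE
  linarith

lemma cNs_nonneg {N : ℕ} {s : ℝ} (hs : s ∈ Set.Ioo (0:ℝ) 1) : 0 ≤ cNs N s := by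
  have h1 : 0 < Real.Gamma (((N:ℝ) + 2*s)/2) :=
    Real.Gamma_pos_of_pos (by have := hs.1; positivity)
  have h2 : 0 < Real.Gamma (1 - s) := Real.Gamma_pos_of_pos (by linarith [hs.2])
  have := Real.pi_pos
  unfold cNs
  positivity

/-- If `v - δ ‖·‖ ^ (2s - N)` has a global maximum at `x ≠ 0`, then the truncated fractional
Laplacians of `v` at `x` are nonnegative. -/
lemma fLapApprox_nonneg_of_max {N : ℕ} (hN : 1 ≤ N) {s δ ε : ℝ} (hs : s ∈ Set.Ioo (0:ℝ) 1)
    (h2s : 2*s < N) (hδ : 0 ≤ δ) (hε : 0 < ε) {v : Euc N → ℝ} {x : Euc N} (hx : x ≠ 0)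
    (hmax : ∀ y, y ≠ 0 → v y - δ * ‖y‖ ^ (2*s - N) ≤ v x - δ * ‖x‖ ^ (2*s - N)) :
    0 ≤ fLapApprox N s v x ε := by
  have : Nonempty (Fin N) := ⟨⟨0, hN⟩⟩
  refine mul_nonneg (cNs_nonneg hs) ?_
  by_cases hv : IntegrableOn (fun y => (v x - v y) / dist x y ^ ((N:ℝ) + 2*s))
      {y : Euc N | ε < dist x y}
  swap
  · exact (integral_undef hv).ge
  obtain ⟨hi, hnn⟩ := integrableOn_fundKernel_and_nonneg hN hs.1 h2s hε hx
  have hle : ∫ y in {y : Euc N | ε < dist x y}, δ * fundKernel N s x y ≤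
      ∫ y in {y : Euc N | ε < dist x y}, (v x - v y) / dist x y ^ ((N:ℝ) + 2*s) := by
    refine setIntegral_mono_ae (hi.const_mul δ) hv ?_
    have h0 : ∀ᵐ y : Euc N, y ≠ 0 := by simp [ae_iff]
    filter_upwards [h0] with y hy
    rw [fundKernel, ← mul_div_assoc]
    gcongr
    linarith [hmax y hy]
  rw [integral_const_mul] at hle
  exact (mul_nonneg hδ hnn).trans hle

/-- Corollary `Liouv`: a solution of `(-Δ)^s v + |v|^{p-1}v = 0` in
`ℝ^N∖{0}` whose positive part vanishes at the prescribed rates at `0` and at infinity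
has nonpositive values. -/
theorem stmt12 (N : ℕ) (hN : 1 ≤ N) (s p τ₀ : ℝ) (hs : s ∈ Set.Ioo (0:ℝ) 1)
    (h2s : 2*s < N) (hp : 0 < p)
    (v : Euc N → ℝ)
    (hC2 : ContDiffOn ℝ 2 v ({(0:Euc N)}ᶜ))
    (hL1 : L1mu N s v)
    (heq : ∀ x : Euc N, x ≠ 0 → HasFracLap N s v x (-(|v x| ^ (p-1) * v x)))
    (hτ : τ₀ ∈ Set.Ioo 0 (2*s)) (hτ2 : 2*s*(p+1) - N*p ≤ τ₀)
    (h0 : Tendsto (fun x : Euc N => ‖x‖ ^ ((N:ℝ) - 2*s) * max (v x) 0)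
      (𝓝[≠] (0:Euc N)) (𝓝 0))
    (hinf : Tendsto (fun x : Euc N => ‖x‖ ^ τ₀ * max (v x) 0)
      (Filter.comap (fun x : Euc N => ‖x‖) atTop) (𝓝 0)) :
    ∀ x : Euc N, x ≠ 0 → v x ≤ 0 := by
  intro x₁ hx₁
  by_contra! hv₁
  have hn₁ : 0 < ‖x₁‖ := norm_pos_iff.2 hx₁
  set w : Euc N → ℝ := fun x => ‖x‖ ^ (2*s - N)
  have hw : ∀ x, x ≠ 0 → 0 < w x := fun x hx => Real.rpow_pos_of_pos (norm_pos_iff.2 hx) _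
  set δ : ℝ := v x₁ / (2 * w x₁)
  have hw₁ := hw x₁ hx₁
  have hδ : 0 < δ := by positivity
  have hg₁ : v x₁ - δ * w x₁ = v x₁ / 2 := by
    simp only [δ]
    field_simp
    ring
  obtain ⟨r, hr, hr'⟩ : ∃ r > 0, ∀ y : Euc N, y ≠ 0 → ‖y‖ < r → v y - δ * w y < 0 := by
    have h := h0.eventually (gt_mem_nhds hδ)
    rw [eventually_nhdsWithin_iff, Metric.eventually_nhds_iff] at h
    obtain ⟨r, hr, h⟩ := h
    refine ⟨r, hr, fun y hy hyr => ?_⟩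
    have h1 := h (by simpa using hyr) hy
    have hyn : 0 < ‖y‖ := norm_pos_iff.2 hy
    have h2 : ‖y‖ ^ ((N:ℝ) - 2*s) * w y = 1 := by
      simp only [w]
      rw [← Real.rpow_add hyn]
      simp
    have h3 : max (v y) 0 < δ * w y := by
      have h4 := mul_lt_mul_of_pos_right h1 (hw y hy)
      rwa [mul_right_comm, h2, one_mul] at h4
    linarith [le_max_left (v y) 0]
  obtain ⟨R, hR⟩ : ∃ R : ℝ, ∀ y : Euc N, y ≠ 0 → R < ‖y‖ → v y - δ * w y < v x₁ / 2 := by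
    have h := hinf.eventually (gt_mem_nhds (half_pos hv₁))
    rw [eventually_comap] at h
    obtain ⟨R, h⟩ := eventually_atTop.1 h
    refine ⟨max R 1, fun y hy hyR => ?_⟩
    have h1 := h ‖y‖ ((le_max_left _ _).trans hyR.le) y rfl
    have h2 : 1 ≤ ‖y‖ ^ τ₀ := Real.one_le_rpow ((le_max_right _ _).trans hyR.le) hτ.1.le
    have h3 : max (v y) 0 ≤ ‖y‖ ^ τ₀ * max (v y) 0 :=
      le_mul_of_one_le_left (le_max_right _ _) h2
    have := mul_pos hδ (hw y hy)
    linarith [le_max_left (v y) 0]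
  have hr₁ : r ≤ ‖x₁‖ := by
    by_contra! h
    linarith [hr' x₁ hx₁ h]
  have hR₁ : ‖x₁‖ ≤ R := by
    by_contra! h
    linarith [hR x₁ hx₁ h]
  set K : Set (Euc N) := closedBall 0 R ∩ {y | r ≤ ‖y‖}
  have hK : IsCompact K :=
    (isCompact_closedBall 0 R).inter_right (isClosed_le continuous_const continuous_norm)
  have hK0 : ∀ y ∈ K, y ≠ 0 := fun y hy => norm_pos_iff.1 (hr.trans_le hy.2)
  have hcont : ContinuousOn (fun y => v y - δ * w y) K := by
    refine (hC2.continuousOn.mono hK0).sub (continuousOn_const.mul ?_)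
    exact continuous_norm.continuousOn.rpow_const fun y hy =>
      Or.inl (norm_ne_zero_iff.2 (hK0 y hy))
  have hx₁K : x₁ ∈ K := ⟨by simpa using hR₁, hr₁⟩
  obtain ⟨x, hxK, hmaxK⟩ := hK.exists_isMaxOn ⟨x₁, hx₁K⟩ hcont
  have hx := hK0 x hxK
  have hge : v x₁ / 2 ≤ v x - δ * w x := hg₁ ▸ hmaxK hx₁K
  have hmax : ∀ y, y ≠ 0 → v y - δ * w y ≤ v x - δ * w x := by
    intro y hy
    rcases lt_or_ge ‖y‖ r with h | h
    · linarith [hr' y hy h]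
    rcases lt_or_ge R ‖y‖ with h' | h'
    · linarith [hR y hy h']
    exact hmaxK ⟨by simpa using h', h⟩
  have hvx : 0 < v x := by
    have := mul_pos hδ (hw x hx)
    linarith
  have hlim : 0 ≤ -(|v x| ^ (p-1) * v x) := by
    refine ge_of_tendsto (heq x hx) ?_
    filter_upwards [self_mem_nhdsWithin] with ε hε
    exact fLapApprox_nonneg_of_max hN hs h2s hδ.le hε hx hmax
  have : 0 < |v x| ^ (p-1) * v x := by positivity
  linarith
end

section
/- Let N ≥ 1 be an integer, s ∈ (0,1) with N > 2s, and p ≥ N/(N−2s). Let Ω ⊂ ℝ^N be a bounded domain containing 0, and let v ∈ C²(Ω∖{0}) ∩ C(ℝ^N∖{0}) ∩ L¹_{μ_s}(ℝ^N) be nonnegative, with v = 0 on ℝ^N∖Ω, satisfying (−Δ)^s v(x) + v(x)^p = 0 for every x ∈ Ω∖{0}. Then v ≡ 0 on ℝ^N∖{0}. -/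
open MeasureTheory Filter Topology Set Metric Asymptotics

lemma euc_nontrivial {N : ℕ} (hN : 1 ≤ N) : Nontrivial (Euc N) := by
  apply Module.nontrivial_of_finrank_pos (R := ℝ)
  simpa using (show 0 < N by omega)

lemma measurableSet_norm_gt {N : ℕ} (ε : ℝ) : MeasurableSet {z : Euc N | ε < ‖z‖} :=
  measurableSet_lt measurable_const measurable_norm

lemma integrableOn_rpow_norm_tail {N : ℕ} (hN : 1 ≤ N) {q : ℝ} (hq : (N : ℝ) < q) {ε : ℝ}
    (hε : 0 < ε) : IntegrableOn (fun z : Euc N => ‖z‖ ^ (-q)) {z | ε < ‖z‖} := by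
  have := euc_nontrivial hN
  rw [← integrable_indicator_iff (measurableSet_norm_gt ε)]
  have h1 : ({z : Euc N | ε < ‖z‖}.indicator fun z => ‖z‖ ^ (-q)) =
      fun z => (Ioi ε).indicator (fun r : ℝ => r ^ (-q)) ‖z‖ := by
    ext z; simp [indicator]
  rw [h1, integrable_fun_norm_addHaar volume]
  have h2 : IntegrableOn ((Ioi ε).indicator fun r : ℝ => r ^ ((N : ℝ) - 1 - q)) (Ioi 0) :=
    ((integrableOn_Ioi_rpow_of_lt (by linarith) hε).integrable_indicator
      measurableSet_Ioi).integrableOn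
  refine h2.congr_fun ?_ measurableSet_Ioi
  intro r (hr : 0 < r)
  by_cases h : ε < r
  · simp only [indicator, mem_Ioi, h, if_true, finrank_euclideanSpace, Fintype.card_fin,
      smul_eq_mul]
    rw [← Real.rpow_natCast, ← Real.rpow_add hr]
    congr 1
    push_cast [hN]; ring
  · simp [indicator, h]

lemma integrableOn_rpow_norm_closedBall {N : ℕ} (hN : 1 ≤ N) {τ : ℝ} (hτ : τ < N) (ρ : ℝ) :
    IntegrableOn (fun z : Euc N => ‖z‖ ^ (-τ)) (closedBall 0 ρ) := by
  have := euc_nontrivial hN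
  have h : IntegrableOn (fun z : Euc N => ‖z‖ ^ (-τ)) (ball 0 (ρ + 1)) := by
    have := integrableOn_fun_norm_addHaar (E := Euc N) volume (f := fun r : ℝ => r ^ (-τ))
      (r := ρ + 1)
    rw [this]
    rcases le_or_gt (ρ + 1) 0 with h0 | h0
    · simp [Ioo_eq_empty (not_lt.2 h0)]
    have h2 := (intervalIntegral.integrableOn_Ioo_rpow_iff (s := (N : ℝ) - 1 - τ) h0).2
      (by linarith)
    refine h2.congr_fun ?_ measurableSet_Ioo
    intro r hr
    simp only [finrank_euclideanSpace, Fintype.card_fin, smul_eq_mul]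
    rw [← Real.rpow_natCast, ← Real.rpow_add hr.1]
    congr 1
    push_cast [hN]; ring
  exact h.mono_set (closedBall_subset_ball (by linarith))

open scoped Pointwise in
lemma setIntegral_rpow_norm_smul {N : ℕ} (τ : ℝ) (S : ℝ → Set (Euc N))
    (hS : ∀ ρ, 0 < ρ → ρ • S 1 = S ρ) {ρ : ℝ} (hρ : 0 < ρ) :
    ∫ z in S ρ, ‖z‖ ^ (-τ) = (∫ z in S 1, ‖z‖ ^ (-τ)) * ρ ^ ((N : ℝ) - τ) := by
  have h := Measure.setIntegral_comp_smul_of_pos (volume : Measure (Euc N))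
    (fun z : Euc N => ‖z‖ ^ (-τ)) (S 1) hρ
  rw [hS ρ hρ] at h
  have h2 : ∀ z : Euc N, ‖ρ • z‖ ^ (-τ) = ‖z‖ ^ (-τ) * ρ ^ (-τ) := by
    intro z
    rw [norm_smul, Real.norm_of_nonneg hρ.le, Real.mul_rpow hρ.le (norm_nonneg _), mul_comm]
  simp only [h2, integral_mul_const, finrank_euclideanSpace, Fintype.card_fin, smul_eq_mul] at h
  rw [sub_eq_add_neg, Real.rpow_add hρ, Real.rpow_natCast]
  field_simp at h
  rw [← h]; ring

open scoped Pointwise in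
lemma setIntegral_rpow_norm_tail {N : ℕ} (q : ℝ) {ρ : ℝ} (hρ : 0 < ρ) :
    ∫ z in {z : Euc N | ρ < ‖z‖}, ‖z‖ ^ (-q) =
      (∫ z in {z : Euc N | 1 < ‖z‖}, ‖z‖ ^ (-q)) * ρ ^ ((N : ℝ) - q) := by
  refine setIntegral_rpow_norm_smul q (fun ρ => {z | ρ < ‖z‖}) (fun r hr => ?_) hρ
  ext z
  rw [mem_smul_set_iff_inv_smul_mem₀ hr.ne']
  simp only [mem_ofPred_eq, norm_smul, norm_inv, Real.norm_of_nonneg hr.le]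
  rw [← div_eq_inv_mul, one_lt_div hr]

open scoped Pointwise in
lemma setIntegral_rpow_norm_closedBall {N : ℕ} (τ : ℝ) {ρ : ℝ} (hρ : 0 < ρ) :
    ∫ z in closedBall (0 : Euc N) ρ, ‖z‖ ^ (-τ) =
      (∫ z in closedBall (0 : Euc N) 1, ‖z‖ ^ (-τ)) * ρ ^ ((N : ℝ) - τ) := by
  refine setIntegral_rpow_norm_smul τ (fun ρ => closedBall 0 ρ) (fun r hr => ?_) hρ
  ext z
  rw [mem_smul_set_iff_inv_smul_mem₀ hr.ne']
  simp only [mem_closedBall_zero_iff, norm_smul, norm_inv, Real.norm_of_nonneg hr.le]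
  rw [← div_eq_inv_mul, div_le_one hr]

lemma setIntegral_inner_annulus {N : ℕ} (a : Euc N) (q ε ρ : ℝ) :
    ∫ z in {z : Euc N | ε < ‖z‖ ∧ ‖z‖ ≤ ρ}, inner ℝ a z * ‖z‖ ^ (-q) = 0 := by
  have hm : MeasurableSet {z : Euc N | ε < ‖z‖ ∧ ‖z‖ ≤ ρ} :=
    (measurableSet_norm_gt ε).inter (measurableSet_le measurable_norm measurable_const)
  rw [← integral_indicator hm]
  set f := {z : Euc N | ε < ‖z‖ ∧ ‖z‖ ≤ ρ}.indicator fun z => inner ℝ a z * ‖z‖ ^ (-q) with hf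
  have h1 : ∀ z, f (-z) = - f z := by
    intro z
    simp only [hf, indicator, mem_ofPred_eq, norm_neg, inner_neg_right]
    split_ifs <;> ring
  have h2 := integral_neg_eq_self f (volume : Measure (Euc N))
  simp only [h1, integral_neg] at h2
  linarith

/-- A one-sided second-order bound near the origin controls a truncated singular integral. -/
lemma setIntegral_le_of_le_quadratic {N : ℕ} (hN : 1 ≤ N) {q : ℝ} (hq : q < N + 2)
    {F : Euc N → ℝ} {a : Euc N} {B ε ρ : ℝ} (hB : 0 ≤ B) (hε : 0 < ε) (hερ : ε < ρ)
    (hF : ∀ z, ‖z‖ ≤ ρ → F z ≤ inner ℝ a z + B * ‖z‖ ^ 2)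
    (hi : IntegrableOn (fun z => F z * ‖z‖ ^ (-q)) {z | ε < ‖z‖}) :
    ∫ z in {z : Euc N | ε < ‖z‖}, F z * ‖z‖ ^ (-q) ≤
      B * ((∫ z in closedBall (0 : Euc N) 1, ‖z‖ ^ (-(q - 2))) * ρ ^ ((N : ℝ) + 2 - q)) +
      ∫ z in {z : Euc N | ρ < ‖z‖}, F z * ‖z‖ ^ (-q) := by
  set A : Set (Euc N) := {z | ε < ‖z‖ ∧ ‖z‖ ≤ ρ} with hA
  have hmA : MeasurableSet A :=
    (measurableSet_norm_gt ε).inter (measurableSet_le measurable_norm measurable_const)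
  have hsplit : {z : Euc N | ε < ‖z‖} = A ∪ {z | ρ < ‖z‖} := by
    ext z
    simp only [hA, mem_ofPred_eq, mem_union]
    constructor
    · intro h
      rcases le_or_gt ‖z‖ ρ with h' | h'
      · exact Or.inl ⟨h, h'⟩
      · exact Or.inr h'
    · rintro (h | h)
      · exact h.1
      · exact hερ.trans h
  have hdisj : Disjoint A {z : Euc N | ρ < ‖z‖} := by
    rw [Set.disjoint_left]
    intro z hz hz'
    exact absurd hz.2 (not_le.2 hz')
  have hAfin : volume A ≠ ⊤ := by
    refine ((measure_mono ?_).trans_lt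
      (measure_closedBall_lt_top (x := (0 : Euc N)) (r := ρ))).ne
    intro z hz
    simpa using hz.2
  have hball := integrableOn_rpow_norm_closedBall hN (τ := q - 2) (by linarith) ρ
  have hsub : A ⊆ closedBall 0 ρ := fun z hz => by simpa using hz.2
  have hi1 : IntegrableOn (fun z : Euc N => inner ℝ a z * ‖z‖ ^ (-q)) A := by
    have hc : ContinuousOn (fun z : Euc N => inner ℝ a z * ‖z‖ ^ (-q))
        {z : Euc N | ε ≤ ‖z‖ ∧ ‖z‖ ≤ ρ} := by
      refine (by fun_prop : Continuous fun z : Euc N => inner ℝ a z).continuousOn.mul ?_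
      refine continuous_norm.continuousOn.rpow_const fun z hz => Or.inl ?_
      have := hz.1
      linarith
    have hcomp : IsCompact {z : Euc N | ε ≤ ‖z‖ ∧ ‖z‖ ≤ ρ} := by
      refine (isCompact_closedBall (0 : Euc N) ρ).of_isClosed_subset ?_ ?_
      · exact (isClosed_le continuous_const continuous_norm).inter
          (isClosed_le continuous_norm continuous_const)
      · intro z hz; simpa using hz.2
    exact (hc.integrableOn_compact hcomp).mono_set fun z hz => ⟨hz.1.le, hz.2⟩
  have hpow : ∀ z ∈ A, B * ‖z‖ ^ 2 * ‖z‖ ^ (-q) = B * ‖z‖ ^ (-(q - 2)) := by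
    intro z hz
    have hz0 : 0 < ‖z‖ := hε.trans hz.1
    rw [← Real.rpow_natCast, mul_assoc, ← Real.rpow_add hz0]
    congr 2; push_cast; ring
  have hi2 : IntegrableOn (fun z : Euc N => B * ‖z‖ ^ 2 * ‖z‖ ^ (-q)) A := by
    refine IntegrableOn.congr_fun (f := fun z : Euc N => B * ‖z‖ ^ (-(q - 2)))
      ((hball.mono_set hsub).const_mul B) (fun z hz => (hpow z hz).symm) hmA
  rw [hsplit] at hi ⊢
  rw [setIntegral_union hdisj (measurableSet_norm_gt ρ) hi.left_of_union hi.right_of_union]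
  gcongr
  calc ∫ z in A, F z * ‖z‖ ^ (-q)
      ≤ ∫ z in A, (inner ℝ a z * ‖z‖ ^ (-q) + B * ‖z‖ ^ 2 * ‖z‖ ^ (-q)) := by
        refine setIntegral_mono_on hi.left_of_union (hi1.add hi2) hmA fun z hz => ?_
        rw [← add_mul]
        exact mul_le_mul_of_nonneg_right (hF z hz.2) (by positivity)
    _ = B * ∫ z in A, ‖z‖ ^ (-(q - 2)) := by
        rw [integral_add hi1 hi2, setIntegral_inner_annulus, zero_add,
          setIntegral_congr_fun hmA hpow, integral_const_mul]
    _ ≤ B * ∫ z in closedBall (0 : Euc N) ρ, ‖z‖ ^ (-(q - 2)) := by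
        exact mul_le_mul_of_nonneg_left (setIntegral_mono_set hball (ae_of_all _ fun z => by positivity)
          (ae_of_all _ hsub)) hB
    _ = _ := by
        rw [setIntegral_rpow_norm_closedBall _ (hε.trans hερ)]
        congr 3; ring

lemma exists_one_add_rpow_neg_le (γ : ℝ) (hγ : 0 ≤ γ) :
    ∃ C : ℝ, 0 ≤ C ∧ ∀ t : ℝ, |t| ≤ 1 / 2 → (1 + t) ^ (-γ) ≤ 1 - γ * t + C * t ^ 2 := by
  refine ⟨2 * γ + γ ^ 2 * 4 * Real.exp (2 * γ), by positivity, fun t ht => ?_⟩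
  obtain ⟨h1, h2⟩ := abs_le.1 ht
  have hpos : 0 < 1 + t := by linarith
  have hlog : t - 2 * t ^ 2 ≤ Real.log (1 + t) := by
    refine le_trans ?_ (Real.one_sub_inv_le_log_of_pos hpos)
    rw [← sub_nonneg]
    have : 1 - (1 + t)⁻¹ - (t - 2 * t ^ 2) = t ^ 2 * (1 + 2 * t) / (1 + t) := by
      field_simp; ring
    rw [this]
    have : 0 ≤ 1 + 2 * t := by linarith
    positivity
  have hexp : ∀ w : ℝ, Real.exp w ≤ 1 + w + w ^ 2 * Real.exp |w| := by
    intro w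
    have h := Complex.norm_exp_sub_sum_le_norm_mul_exp (w : ℂ) 2
    simp only [Finset.sum_range_succ, Finset.sum_range_zero, pow_zero, pow_one,
      Nat.factorial, zero_add, Complex.norm_real, Real.norm_eq_abs, sq_abs] at h
    have h3 : Complex.exp w - ((1 : ℂ) / ((1 : ℕ) : ℂ) + w / ((1 * 1 : ℕ) : ℂ)) =
        ((Real.exp w - (1 + w) : ℝ) : ℂ) := by
      push_cast; ring
    simp only [Nat.succ_eq_add_one, zero_add] at h
    rw [h3, Complex.norm_real, Real.norm_eq_abs] at h
    linarith [(abs_le.1 h).2]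
  have hw : |(-γ * (t - 2 * t ^ 2))| ≤ 2 * γ * |t| := by
    rw [abs_mul, abs_neg, abs_of_nonneg hγ, show t - 2 * t ^ 2 = t * (1 - 2 * t) by ring, abs_mul]
    have : |1 - 2 * t| ≤ 2 := abs_le.2 ⟨by linarith, by linarith⟩
    calc γ * (|t| * |1 - 2 * t|) ≤ γ * (|t| * 2) := by gcongr
      _ = _ := by ring
  have hw2 : (-γ * (t - 2 * t ^ 2)) ^ 2 ≤ γ ^ 2 * 4 * t ^ 2 := by
    rw [← sq_abs]
    calc |(-γ * (t - 2 * t ^ 2))| ^ 2 ≤ (2 * γ * |t|) ^ 2 := by gcongr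
      _ = γ ^ 2 * 4 * t ^ 2 := by rw [mul_pow, sq_abs]; ring
  calc (1 + t) ^ (-γ) = Real.exp (Real.log (1 + t) * -γ) := Real.rpow_def_of_pos hpos _
    _ ≤ Real.exp (-γ * (t - 2 * t ^ 2)) := by
        apply Real.exp_le_exp.2
        nlinarith
    _ ≤ _ := hexp _
    _ ≤ 1 + -γ * (t - 2 * t ^ 2) + γ ^ 2 * 4 * t ^ 2 * Real.exp (2 * γ) := by
        gcongr
        refine hw.trans ?_
        nlinarith [abs_nonneg t]
    _ = _ := by ring

/-- A one-sided second-order bound for a shifted negative power of the norm. -/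
lemma exists_rpow_norm_sub_le (N : ℕ) (γ : ℝ) (hγ : 0 ≤ γ) :
    ∃ C : ℝ, 0 ≤ C ∧ ∀ (x z : Euc N) (δ d : ℝ), 0 ≤ δ → 0 < d → ‖x‖ = δ + d → ‖z‖ ≤ d / 2 →
      0 < ‖x + z‖ - δ ∧ (‖x + z‖ - δ) ^ (-γ) ≤
        d ^ (-γ) * (1 + inner ℝ (-(γ / (d * ‖x‖)) • x) z + C / d ^ 2 * ‖z‖ ^ 2) := by
  obtain ⟨C, hC, h⟩ := exists_one_add_rpow_neg_le γ hγ
  refine ⟨C, hC, fun x z δ d hδ hd hx hz => ?_⟩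
  have hx0 : 0 < ‖x‖ := by linarith
  set t := inner ℝ x z / ‖x‖ with ht
  have ht1 : |t| ≤ ‖z‖ := by
    rw [ht, abs_div, abs_norm, div_le_iff₀ hx0, mul_comm]
    exact abs_real_inner_le_norm x z
  have hnorm : ‖x‖ + t ≤ ‖x + z‖ := by
    have h1 : inner ℝ x (x + z) ≤ ‖x‖ * ‖x + z‖ := real_inner_le_norm _ _
    rw [inner_add_right, real_inner_self_eq_norm_sq] at h1
    have h2 : inner ℝ x z = ‖x‖ * t := by rw [ht]; field_simp
    rw [h2] at h1
    nlinarith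
  have htd : |t / d| ≤ 1 / 2 := by
    rw [abs_div, abs_of_pos hd, div_le_iff₀ hd]; linarith
  have h3 := (abs_le.1 htd).1
  have h4 : d * (1 + t / d) ≤ ‖x + z‖ - δ := by
    rw [mul_add, mul_div_cancel₀ _ hd.ne']; linarith
  have h5 : 0 < 1 + t / d := by linarith
  have h6 : 0 < d * (1 + t / d) := by positivity
  refine ⟨h6.trans_le h4, ?_⟩
  calc (‖x + z‖ - δ) ^ (-γ) ≤ (d * (1 + t / d)) ^ (-γ) :=
        Real.rpow_le_rpow_of_nonpos h6 h4 (by linarith)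
    _ = d ^ (-γ) * (1 + t / d) ^ (-γ) := Real.mul_rpow hd.le h5.le
    _ ≤ d ^ (-γ) * (1 - γ * (t / d) + C * (t / d) ^ 2) := by gcongr; exact h _ htd
    _ ≤ _ := by
        have e1 : inner ℝ (-(γ / (d * ‖x‖)) • x) z = -(γ * (t / d)) := by
          rw [real_inner_smul_left, ht]; field_simp
        have e2 : C * (t / d) ^ 2 ≤ C / d ^ 2 * ‖z‖ ^ 2 := by
          rw [div_pow, mul_div_assoc', div_mul_eq_mul_div, ← sq_abs t]
          gcongr
        rw [e1]
        refine mul_le_mul_of_nonneg_left ?_ (by positivity)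
        linarith

lemma rpow_norm_mul_tail {N : ℕ} (hN : 1 ≤ N) {q τ : ℝ} (hq : (N : ℝ) < q) (h0 : 0 ≤ τ)
    (hτ : τ < N) (x : Euc N) {ε r : ℝ} (hε : 0 < ε) (hr : 0 < r) :
    IntegrableOn (fun z : Euc N => ‖x + z‖ ^ (-τ) * ‖z‖ ^ (-q)) {z | ε < ‖z‖} ∧
    ∫ z in {z : Euc N | ε < ‖z‖}, ‖x + z‖ ^ (-τ) * ‖z‖ ^ (-q) ≤
      ε ^ (-q) * ((∫ z in closedBall (0 : Euc N) 1, ‖z‖ ^ (-τ)) * r ^ ((N : ℝ) - τ)) +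
      r ^ (-τ) * ((∫ z in {z : Euc N | 1 < ‖z‖}, ‖z‖ ^ (-q)) * ε ^ ((N : ℝ) - q)) := by
  set g : Euc N → ℝ := (closedBall 0 r).indicator (fun z => ‖z‖ ^ (-τ)) with hg
  have hgi : Integrable g :=
    (integrableOn_rpow_norm_closedBall hN hτ r).integrable_indicator measurableSet_closedBall
  have hgx : Integrable (fun z => g (x + z)) := hgi.comp_add_left x
  have hk := integrableOn_rpow_norm_tail hN hq hε
  have hg0 : ∀ z, 0 ≤ g z := fun z => indicator_nonneg (fun _ _ => by positivity) z
  have hdom : ∀ z ∈ {z : Euc N | ε < ‖z‖}, ‖x + z‖ ^ (-τ) * ‖z‖ ^ (-q) ≤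
      ε ^ (-q) * g (x + z) + r ^ (-τ) * ‖z‖ ^ (-q) := by
    intro z (hz : ε < ‖z‖)
    have hz0 : 0 ≤ ‖z‖ ^ (-q) := by positivity
    have hzq : ‖z‖ ^ (-q) ≤ ε ^ (-q) :=
      Real.rpow_le_rpow_of_nonpos hε hz.le (by linarith [(Nat.cast_nonneg N : (0:ℝ) ≤ N)])
    by_cases hc : ‖x + z‖ ≤ r
    · have : g (x + z) = ‖x + z‖ ^ (-τ) := indicator_of_mem (by simpa using hc) _
      rw [this, mul_comm]
      have : 0 ≤ r ^ (-τ) * ‖z‖ ^ (-q) := by positivity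
      have : ‖z‖ ^ (-q) * ‖x + z‖ ^ (-τ) ≤ ε ^ (-q) * ‖x + z‖ ^ (-τ) := by gcongr
      linarith
    · push Not at hc
      have h1 : ‖x + z‖ ^ (-τ) ≤ r ^ (-τ) :=
        Real.rpow_le_rpow_of_nonpos hr hc.le (by linarith)
      have h2 : 0 ≤ ε ^ (-q) * g (x + z) := mul_nonneg (by positivity) (hg0 _)
      have : ‖x + z‖ ^ (-τ) * ‖z‖ ^ (-q) ≤ r ^ (-τ) * ‖z‖ ^ (-q) := by gcongr
      linarith
  have hdi : IntegrableOn (fun z => ε ^ (-q) * g (x + z) + r ^ (-τ) * ‖z‖ ^ (-q))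
      {z : Euc N | ε < ‖z‖} := (hgx.integrableOn.const_mul _).add (hk.const_mul _)
  have hv_int : IntegrableOn (fun z : Euc N => ‖x + z‖ ^ (-τ) * ‖z‖ ^ (-q)) {z | ε < ‖z‖} := by
    refine Integrable.mono' hdi ?_ ?_
    · exact Measurable.aestronglyMeasurable (by fun_prop)
    · refine (ae_restrict_iff' (measurableSet_norm_gt ε)).2 (ae_of_all _ fun z hz => ?_)
      rw [Real.norm_of_nonneg (by positivity)]
      exact hdom z hz
  refine ⟨hv_int, ?_⟩
  calc ∫ z in {z : Euc N | ε < ‖z‖}, ‖x + z‖ ^ (-τ) * ‖z‖ ^ (-q)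
      ≤ ∫ z in {z : Euc N | ε < ‖z‖}, (ε ^ (-q) * g (x + z) + r ^ (-τ) * ‖z‖ ^ (-q)) :=
        setIntegral_mono_on hv_int hdi (measurableSet_norm_gt ε) hdom
    _ = ε ^ (-q) * (∫ z in {z : Euc N | ε < ‖z‖}, g (x + z)) +
          r ^ (-τ) * ∫ z in {z : Euc N | ε < ‖z‖}, ‖z‖ ^ (-q) := by
        rw [integral_add (hgx.integrableOn.const_mul _) (hk.const_mul _), integral_const_mul,
          integral_const_mul]
    _ ≤ ε ^ (-q) * (∫ z, g z) + r ^ (-τ) * ∫ z in {z : Euc N | ε < ‖z‖}, ‖z‖ ^ (-q) := by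
        gcongr
        rw [← integral_add_left_eq_self g x]
        exact setIntegral_le_integral hgx (ae_of_all _ fun z => hg0 _)
    _ = _ := by
        rw [hg, integral_indicator measurableSet_closedBall,
          setIntegral_rpow_norm_closedBall _ hr, setIntegral_rpow_norm_tail _ hε]

lemma integrableOn_rpow_norm_sub {N : ℕ} (hN : 1 ≤ N) {q τ : ℝ} (hq : (N : ℝ) < q) (h0 : 0 ≤ τ)
    (hτ : τ < N) (x : Euc N) {ε : ℝ} (hε : 0 < ε) :
    IntegrableOn (fun z : Euc N => (‖x + z‖ ^ (-τ) - ‖x‖ ^ (-τ)) * ‖z‖ ^ (-q))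
      {z | ε < ‖z‖} := by
  simp only [sub_mul]
  exact (rpow_norm_mul_tail hN hq h0 hτ x hε one_pos).1.sub
    ((integrableOn_rpow_norm_tail hN hq hε).const_mul _)

/-- Truncated fractional Laplacians of `‖x‖ ^ (-τ)` are at least `-C ‖x‖ ^ (-τ-2s)`. -/
lemma exists_truncated_rpow_norm_le {N : ℕ} (hN : 1 ≤ N) {q τ : ℝ} (hq : (N : ℝ) < q)
    (hq2 : q < N + 2) (h0 : 0 ≤ τ) (hτ : τ < N) :
    ∃ C : ℝ, 0 ≤ C ∧ ∀ x : Euc N, x ≠ 0 → ∀ ε, 0 < ε → ε < ‖x‖ / 2 →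
      ∫ z in {z : Euc N | ε < ‖z‖}, (‖x + z‖ ^ (-τ) - ‖x‖ ^ (-τ)) * ‖z‖ ^ (-q) ≤
        C * ‖x‖ ^ (-τ + N - q) := by
  obtain ⟨C₁, hC₁, h1⟩ := exists_rpow_norm_sub_le N τ h0
  set I₁ := ∫ z in closedBall (0 : Euc N) 1, ‖z‖ ^ (-(q - 2)) with hI₁
  set I₂ := ∫ z in closedBall (0 : Euc N) 1, ‖z‖ ^ (-τ) with hI₂
  set I₃ := ∫ z in {z : Euc N | 1 < ‖z‖}, ‖z‖ ^ (-q) with hI₃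
  have hI₁0 : 0 ≤ I₁ := integral_nonneg fun z => by positivity
  have hI₂0 : 0 ≤ I₂ := integral_nonneg fun z => by positivity
  have hI₃0 : 0 ≤ I₃ := integral_nonneg fun z => by positivity
  refine ⟨C₁ * I₁ * (2:ℝ)⁻¹ ^ ((N:ℝ) + 2 - q) + (2:ℝ)⁻¹ ^ (-q) * I₂ +
    I₃ * (2:ℝ)⁻¹ ^ ((N:ℝ) - q), by positivity, fun x hx ε hε hεx => ?_⟩
  have hx0 : 0 < ‖x‖ := norm_pos_iff.2 hx
  have hi := integrableOn_rpow_norm_sub hN hq h0 hτ x hε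
  have h2 := setIntegral_le_of_le_quadratic hN hq2 (ρ := ‖x‖ / 2)
    (F := fun z : Euc N => ‖x + z‖ ^ (-τ) - ‖x‖ ^ (-τ))
    (a := ‖x‖ ^ (-τ) • (-(τ / (‖x‖ * ‖x‖)) • x)) (B := ‖x‖ ^ (-τ) * (C₁ / ‖x‖ ^ 2))
    (by positivity) hε hεx (fun z hz => by
      have := (h1 x z 0 ‖x‖ le_rfl hx0 (by simp) hz).2
      simp only [sub_zero] at this
      rw [real_inner_smul_left]
      linarith) hi
  refine h2.trans ?_
  have h3 := (rpow_norm_mul_tail hN hq h0 hτ x (half_pos hx0) hx0)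
  have h4 : ∫ z in {z : Euc N | ‖x‖ / 2 < ‖z‖}, (‖x + z‖ ^ (-τ) - ‖x‖ ^ (-τ)) * ‖z‖ ^ (-q) ≤
      ∫ z in {z : Euc N | ‖x‖ / 2 < ‖z‖}, ‖x + z‖ ^ (-τ) * ‖z‖ ^ (-q) := by
    refine setIntegral_mono_on (integrableOn_rpow_norm_sub hN hq h0 hτ x (half_pos hx0)) h3.1
      (measurableSet_norm_gt _) fun z _ => ?_
    have : 0 ≤ ‖x‖ ^ (-τ) := by positivity
    gcongr
    linarith
  refine (add_le_add_right (h4.trans h3.2) _).trans (le_of_eq ?_)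
  have e : ∀ a : ℝ, (‖x‖ / 2) ^ a = (2:ℝ)⁻¹ ^ a * ‖x‖ ^ a := by
    intro a
    rw [div_eq_inv_mul, Real.mul_rpow (by norm_num) hx0.le]
  have e1 : ‖x‖ ^ (-τ) * ‖x‖ ^ ((N:ℝ) + 2 - q) = ‖x‖ ^ (-τ + N - q) * ‖x‖ ^ 2 := by
    rw [← Real.rpow_natCast, ← Real.rpow_add hx0, ← Real.rpow_add hx0]
    congr 1; push_cast; ring
  have e2 : ‖x‖ ^ (-q) * ‖x‖ ^ ((N:ℝ) - τ) = ‖x‖ ^ (-τ + N - q) := by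
    rw [← Real.rpow_add hx0]; congr 1; ring
  have e3 : ‖x‖ ^ (-τ) * ‖x‖ ^ ((N:ℝ) - q) = ‖x‖ ^ (-τ + N - q) := by
    rw [← Real.rpow_add hx0]; congr 1; ring
  rw [e, e, e]
  have t1 : ‖x‖ ^ (-τ) * (C₁ / ‖x‖ ^ 2) * (I₁ * ((2:ℝ)⁻¹ ^ ((N:ℝ) + 2 - q) *
      ‖x‖ ^ ((N:ℝ) + 2 - q))) =
      C₁ * I₁ * (2:ℝ)⁻¹ ^ ((N:ℝ) + 2 - q) * ‖x‖ ^ (-τ + N - q) := by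
    calc _ = C₁ * I₁ * (2:ℝ)⁻¹ ^ ((N:ℝ) + 2 - q) *
        (‖x‖ ^ (-τ) * ‖x‖ ^ ((N:ℝ) + 2 - q)) / ‖x‖ ^ 2 := by ring
      _ = _ := by rw [e1]; field_simp
  have t2 : (2:ℝ)⁻¹ ^ (-q) * ‖x‖ ^ (-q) * (I₂ * ‖x‖ ^ ((N:ℝ) - τ)) =
      (2:ℝ)⁻¹ ^ (-q) * I₂ * ‖x‖ ^ (-τ + N - q) := by rw [← e2]; ring
  have t3 : ‖x‖ ^ (-τ) * (I₃ * ((2:ℝ)⁻¹ ^ ((N:ℝ) - q) * ‖x‖ ^ ((N:ℝ) - q))) =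
      I₃ * (2:ℝ)⁻¹ ^ ((N:ℝ) - q) * ‖x‖ ^ (-τ + N - q) := by rw [← e3]; ring
  rw [t1, t2, t3]
  ring

lemma cNs_pos (N : ℕ) {s : ℝ} (hs : s ∈ Ioo (0:ℝ) 1) : 0 < cNs N s := by
  have h1 : 0 < Real.Gamma (((N:ℝ) + 2*s)/2) := Real.Gamma_pos_of_pos (by
    have := hs.1; positivity)
  have h2 : 0 < Real.Gamma (1 - s) := Real.Gamma_pos_of_pos (by linarith [hs.2])
  have := Real.pi_pos
  unfold cNs
  positivity

lemma fLapApprox_eq (N : ℕ) (s : ℝ) (w : Euc N → ℝ) (x : Euc N) (ε : ℝ) :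
    fLapApprox N s w x ε = -(cNs N s *
      ∫ z in {z : Euc N | ε < ‖z‖}, (w (x + z) - w x) * ‖z‖ ^ (-((N:ℝ) + 2*s))) := by
  have hm : MeasurableSet {y : Euc N | ε < dist x y} :=
    measurableSet_lt measurable_const (by fun_prop)
  rw [fLapApprox, ← integral_indicator hm, ← integral_add_left_eq_self _ x,
    ← integral_indicator (measurableSet_norm_gt ε), ← mul_neg, ← integral_neg]
  congr 2
  ext z
  simp only [indicator, mem_ofPred_eq, dist_self_add_right]
  split_ifs
  · rw [Real.rpow_neg (norm_nonneg _)]; ring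
  · simp

/-- A bound on the truncated integrals at a point bounds the value of the absorption term. -/
lemma le_of_hasFracLap {N : ℕ} {s : ℝ} (hs : s ∈ Ioo (0:ℝ) 1) {w : Euc N → ℝ} {x : Euc N}
    {L A₀ : ℝ} (h : HasFracLap N s w x (-L)) {A : ℝ → ℝ} (hA : Tendsto A (𝓝[>] 0) (𝓝 A₀))
    (hle : ∀ᶠ ε in 𝓝[>] (0:ℝ),
      ∫ z in {z : Euc N | ε < ‖z‖}, (w (x + z) - w x) * ‖z‖ ^ (-((N:ℝ) + 2*s)) ≤ A ε) :
    L ≤ cNs N s * A₀ := by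
  have h1 := h.neg
  rw [neg_neg] at h1
  refine le_of_tendsto_of_tendsto h1 (hA.const_mul (cNs N s)) ?_
  filter_upwards [hle] with ε hε
  rw [fLapApprox_eq, neg_neg]
  exact mul_le_mul_of_nonneg_left hε (cNs_pos N hs).le

lemma integrableOn_sub_mul_tail {N : ℕ} (hN : 1 ≤ N) {q : ℝ} (hq : (N : ℝ) < q)
    {w : Euc N → ℝ} (hw : Integrable w) (x : Euc N) {ε : ℝ} (hε : 0 < ε) :
    IntegrableOn (fun z => (w (x + z) - w x) * ‖z‖ ^ (-q)) {z | ε < ‖z‖} ∧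
    IntegrableOn (fun z => w (x + z) * ‖z‖ ^ (-q)) {z | ε < ‖z‖} := by
  have h1 : IntegrableOn (fun z => w (x + z) * ‖z‖ ^ (-q)) {z | ε < ‖z‖} := by
    refine Integrable.mul_bdd (c := ε ^ (-q)) (hw.comp_add_left x).integrableOn
      (Measurable.aestronglyMeasurable (by fun_prop)) ?_
    refine (ae_restrict_iff' (measurableSet_norm_gt ε)).2 (ae_of_all _ fun z hz => ?_)
    rw [Real.norm_of_nonneg (by positivity)]
    exact Real.rpow_le_rpow_of_nonpos hε (le_of_lt hz)
      (by linarith [(Nat.cast_nonneg N : (0:ℝ) ≤ N)])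
  refine ⟨?_, h1⟩
  simp only [sub_mul]
  exact h1.sub ((integrableOn_rpow_norm_tail hN hq hε).const_mul _)

lemma measurableSet_ne_zero_and_lt {N : ℕ} {f g : Euc N → ℝ} (hf : Measurable f)
    (hg : Measurable g) : MeasurableSet {y : Euc N | y ≠ 0 ∧ f y < g y} :=
  (measurableSet_singleton (0 : Euc N)).compl.inter (measurableSet_lt hf hg)

open EuclideanGeometry in
/-- The Kelvin transform of a constant is antisymmetric under inversion. -/
lemma setIntegral_inversion {N : ℕ} {b q : ℝ} (hbq : b + q = 2 * N) {x : Euc N} (hx : x ≠ 0)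
    {ε : ℝ} :
    ∫ y in {y : Euc N | y ≠ 0 ∧ ε < dist x y},
        (‖y‖ ^ (-b) - ‖x‖ ^ (-b)) * dist x y ^ (-q) =
      -∫ y in {y : Euc N | y ≠ 0 ∧ ε * ‖y‖ < ‖x‖ * dist x y},
        (‖y‖ ^ (-b) - ‖x‖ ^ (-b)) * dist x y ^ (-q) := by
  set R := ‖x‖ with hR
  have hR0 : 0 < R := norm_pos_iff.2 hx
  set S := {y : Euc N | y ≠ 0 ∧ ε * ‖y‖ < R * dist x y} with hS
  have hxfix : inversion (0 : Euc N) R x = x :=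
    inversion_of_mem_sphere (by simp [hR])
  have hdist : ∀ z : Euc N, z ≠ 0 → dist x (inversion 0 R z) = R / ‖z‖ * dist x z := by
    intro z hz
    have hz0 : 0 < ‖z‖ := norm_pos_iff.2 hz
    have := dist_inversion_inversion hx hz R
    rw [hxfix] at this
    rw [this, dist_zero_right, dist_zero_right, ← hR]
    field_simp
  have hnorm : ∀ z : Euc N, ‖inversion (0 : Euc N) R z‖ = R ^ 2 / ‖z‖ := by
    intro z
    simpa using dist_inversion_center (0 : Euc N) z R
  have himage : inversion (0 : Euc N) R '' S = {y : Euc N | y ≠ 0 ∧ ε < dist x y} := by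
    rw [(inversion_involutive (0 : Euc N) hR0.ne').image_eq_preimage_symm]
    ext z
    simp only [hS, mem_preimage, mem_ofPred_eq, ne_eq, inversion_eq_center hR0.ne']
    refine and_congr_right fun hz => ?_
    have hz0 : 0 < ‖z‖ := norm_pos_iff.2 hz
    rw [hdist z hz, hnorm]
    rw [show ε * (R ^ 2 / ‖z‖) = R ^ 2 / ‖z‖ * ε by ring,
      show R * (R / ‖z‖ * dist x z) = R ^ 2 / ‖z‖ * dist x z by ring]
    exact mul_lt_mul_iff_right₀ (by positivity)
  have hSm : MeasurableSet S := measurableSet_ne_zero_and_lt (by fun_prop) (by fun_prop)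
  rw [← himage, integral_image_eq_integral_abs_det_fderiv_smul volume hSm
    (fun z hz => (hasFDerivAt_inversion hz.1).hasFDerivWithinAt)
    (inversion_injective _ hR0.ne').injOn, ← integral_neg]
  refine setIntegral_congr_fun hSm fun z hz => ?_
  have hz0 : 0 < ‖z‖ := norm_pos_iff.2 hz.1
  have hdet : |(((R / dist z 0) ^ 2 • ((ℝ ∙ (z - 0))ᗮ.reflection : Euc N →L[ℝ] Euc N)) :
      Euc N →L[ℝ] Euc N).det| = ((R / ‖z‖) ^ 2) ^ N := by
    rw [ContinuousLinearMap.det, ContinuousLinearMap.toLinearMap_smul, LinearMap.det_smul]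
    have h := (ℝ ∙ (z - 0))ᗮ.det_reflection
    have h2 : LinearMap.det (((ℝ ∙ (z - 0))ᗮ.reflection : Euc N →L[ℝ] Euc N) :
        Euc N →ₗ[ℝ] Euc N) = _ := h
    rw [h2, abs_mul, abs_neg_one_pow, mul_one, abs_of_nonneg (by positivity),
      finrank_euclideanSpace, Fintype.card_fin, dist_zero_right]
  simp only [smul_eq_mul]
  rw [hdet, hnorm, hdist z hz.1]
  set l := R / ‖z‖ with hl
  have hl0 : 0 < l := by positivity
  have e1 : R ^ 2 / ‖z‖ = l * R := by rw [hl]; ring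
  have e2 : ‖z‖ = R * l⁻¹ := by rw [hl]; field_simp
  have e3 : (l ^ 2) ^ N = l ^ b * l ^ q := by
    rw [← Real.rpow_add hl0, hbq, ← pow_mul, ← Real.rpow_natCast]; push_cast; rfl
  rw [e1, e2, e3, Real.mul_rpow hl0.le hR0.le, Real.mul_rpow hR0.le (by positivity),
    Real.mul_rpow hl0.le dist_nonneg, Real.inv_rpow hl0.le, Real.rpow_neg hl0.le,
    Real.rpow_neg hl0.le q]
  have h1 : 0 < l ^ b := by positivity
  have h2 : 0 < l ^ q := by positivity
  field_simp
  ring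

lemma measureReal_shell_le {N : ℕ} (x : Euc N) {ε R : ℝ} (hε : 0 < ε) (hεR : ε < R / 2) :
    volume.real {y : Euc N | ε * (1 - ε / R) < dist x y ∧ dist x y ≤ ε / (1 - ε / R)} ≤
      volume.real (ball (0 : Euc N) 1) * (4 * ε ^ 2 / R * N * (2 * ε) ^ (N - 1)) := by
  have hR : 0 < R := by linarith
  set u := ε / R with hu
  have hu0 : 0 < u := by positivity
  have hu1 : u < 1 / 2 := by rw [hu, div_lt_iff₀ hR]; linarith
  have h1u : 0 < 1 - u := by linarith
  have hset : {y : Euc N | ε * (1 - u) < dist x y ∧ dist x y ≤ ε / (1 - u)} =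
      closedBall x (ε / (1 - u)) \ closedBall x (ε * (1 - u)) := by
    ext y; simp [dist_comm y x, and_comm]
  have hr12 : ε * (1 - u) ≤ ε / (1 - u) := by
    have : (1 - u) * (1 - u) ≤ 1 := by nlinarith
    rw [le_div_iff₀ h1u]; nlinarith
  have hr2 : ε / (1 - u) ≤ 2 * ε := by
    rw [div_le_iff₀ h1u]; nlinarith
  have hdiff : ε / (1 - u) - ε * (1 - u) ≤ 4 * ε ^ 2 / R := by
    have : 4 * ε ^ 2 / R = 4 * ε * u := by rw [hu]; ring
    rw [this, sub_le_iff_le_add, div_le_iff₀ h1u]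
    nlinarith [mul_pos hε hu0, mul_pos (mul_pos hε hu0) h1u, mul_pos (mul_pos hε hu0) hu0]
  rw [hset, measureReal_sdiff (closedBall_subset_closedBall hr12) measurableSet_closedBall
    (measure_closedBall_lt_top.ne)]
  simp only [Measure.real, Measure.addHaar_closedBall _ x (show 0 ≤ ε / (1 - u) by positivity),
    Measure.addHaar_closedBall _ x (show 0 ≤ ε * (1 - u) by positivity), ENNReal.toReal_mul,
    finrank_euclideanSpace, Fintype.card_fin]
  rw [ENNReal.toReal_ofReal (by positivity), ENNReal.toReal_ofReal (by positivity), ← sub_mul,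
    mul_comm]
  refine mul_le_mul_of_nonneg_left ?_ ENNReal.toReal_nonneg
  refine (le_abs_self _).trans ((abs_pow_sub_pow_le _ _ _).trans ?_)
  rw [abs_of_nonneg (sub_nonneg.2 hr12), abs_of_nonneg (show 0 ≤ ε / (1 - u) by positivity),
    abs_of_nonneg (show 0 ≤ ε * (1 - u) by positivity), max_eq_left hr12]
  gcongr

/-- The fundamental solution `‖x‖ ^ (2s - N)` is `s`-harmonic away from the origin. -/
lemma tendsto_truncated_fundamental {N : ℕ} (hN : 1 ≤ N) {b q : ℝ} (hbq : b + q = 2 * N)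
    (hb : 0 ≤ b) (hq : (N : ℝ) < q) (hq2 : q < N + 2) {x : Euc N} (hx : x ≠ 0) :
    Tendsto (fun ε => ∫ z in {z : Euc N | ε < ‖z‖}, (‖x + z‖ ^ (-b) - ‖x‖ ^ (-b)) * ‖z‖ ^ (-q))
      (𝓝[>] 0) (𝓝 0) := by
  have := euc_nontrivial hN
  have hx0 : 0 < ‖x‖ := norm_pos_iff.2 hx
  set R := ‖x‖ with hR
  have hbN : b < N := by linarith
  set f : Euc N → ℝ := fun y => (‖y‖ ^ (-b) - R ^ (-b)) * dist x y ^ (-q) with hf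
  have hmD : ∀ ε : ℝ, MeasurableSet {y : Euc N | y ≠ 0 ∧ ε < dist x y} := fun ε =>
    measurableSet_ne_zero_and_lt (by fun_prop) (by fun_prop)
  have hmS : ∀ ε : ℝ, MeasurableSet {y : Euc N | y ≠ 0 ∧ ε * ‖y‖ < R * dist x y} := fun ε =>
    measurableSet_ne_zero_and_lt (by fun_prop) (by fun_prop)
  have hind : ∀ ε : ℝ, (fun z => ({y : Euc N | ε < dist x y}.indicator f) (x + z)) =
      {z : Euc N | ε < ‖z‖}.indicator
        (fun z => (‖x + z‖ ^ (-b) - R ^ (-b)) * ‖z‖ ^ (-q)) := by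
    intro ε; ext z
    simp [indicator, hf]
  have hm : ∀ ε : ℝ, MeasurableSet {y : Euc N | ε < dist x y} := fun ε =>
    measurableSet_lt measurable_const (by fun_prop)
  have hconv : ∀ ε : ℝ, ∫ z in {z : Euc N | ε < ‖z‖},
      (‖x + z‖ ^ (-b) - R ^ (-b)) * ‖z‖ ^ (-q) =
      ∫ y in {y : Euc N | y ≠ 0 ∧ ε < dist x y}, f y := by
    intro ε
    rw [← integral_indicator (measurableSet_norm_gt ε), ← hind,
      integral_add_left_eq_self, integral_indicator (hm ε)]
    refine setIntegral_congr_set ?_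
    have h0 : ∀ᵐ y : Euc N, y ≠ 0 := by
      simp [ae_iff]
    filter_upwards [h0] with y hy
    apply propext
    change ε < dist x y ↔ (y ≠ 0 ∧ ε < dist x y)
    simp [hy]
  have hfint : ∀ ε : ℝ, 0 < ε → IntegrableOn f {y : Euc N | ε < dist x y} := by
    intro ε hε
    have h1 := integrableOn_rpow_norm_sub hN hq hb hbN x hε
    rw [← integrable_indicator_iff (measurableSet_norm_gt ε), ← hR, ← hind] at h1
    rw [← integrable_indicator_iff (hm ε)]
    have h2 := h1.comp_add_left (-x)
    simpa using h2
  -- Lipschitz bound near `x`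
  have hdiff : DifferentiableAt ℝ (fun y : Euc N => ‖y‖ ^ (-b)) x :=
    (differentiableAt_id.norm ℝ hx).rpow_const (Or.inl hx0.ne')
  obtain ⟨L, hL0, hL⟩ := hdiff.isBigO_sub.exists_nonneg
  obtain ⟨η, hη, hLη⟩ := Metric.eventually_nhds_iff.1 hL.bound
  set ω := volume.real (ball (0 : Euc N) 1)
  set Cst : ℝ := L * (2:ℝ)⁻¹ ^ (1 - q) * ω * (4 / R * N * 2 ^ (N - 1)) with hCst
  have hmain : ∀ᶠ ε in 𝓝[>] (0:ℝ), ‖∫ z in {z : Euc N | ε < ‖z‖},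
      (‖x + z‖ ^ (-b) - R ^ (-b)) * ‖z‖ ^ (-q)‖ ≤ Cst * ε ^ ((N:ℝ) + 2 - q) := by
    have hsmall : ∀ᶠ ε in 𝓝[>] (0:ℝ), ε < min (R / 2) (η / 2) :=
      eventually_nhdsWithin_of_eventually_nhds (eventually_lt_nhds (by positivity))
    filter_upwards [hsmall, self_mem_nhdsWithin] with ε hε1 (hε0 : 0 < ε)
    have hεR : ε < R / 2 := hε1.trans_le (min_le_left _ _)
    have hεη : ε < η / 2 := hε1.trans_le (min_le_right _ _)
    rw [hconv]
    set D := {y : Euc N | y ≠ 0 ∧ ε < dist x y} with hD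
    set S := {y : Euc N | y ≠ 0 ∧ ε * ‖y‖ < R * dist x y} with hS
    set Sh := {y : Euc N | ε * (1 - ε / R) < dist x y ∧ dist x y ≤ ε / (1 - ε / R)} with hSh
    have hu1 : ε / R < 1 / 2 := by rw [div_lt_iff₀ hx0]; linarith
    have hu0 : 0 < ε / R := by positivity
    have h1u : 0 < 1 - ε / R := by linarith
    have hDi : IntegrableOn f D := (hfint ε hε0).mono_set fun y hy => hy.2
    have htri : ∀ y : Euc N, ‖y‖ ≤ R + dist x y ∧ R ≤ ‖y‖ + dist x y := by
      intro y
      rw [dist_eq_norm, hR]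
      constructor
      · have := norm_sub_norm_le y x
        rw [norm_sub_rev] at this; linarith
      · have := norm_sub_norm_le x y; linarith
    have hSi : IntegrableOn f S := by
      refine (hfint (ε / 3) (by positivity)).mono_set fun y hy => ?_
      obtain ⟨-, hy⟩ := hy
      have h := (htri y).2
      change ε / 3 < dist x y
      by_contra hc
      push Not at hc
      have : 2 / 3 * R ≤ ‖y‖ := by linarith
      have h1 : ε * (2 / 3 * R) ≤ ε * ‖y‖ := by gcongr
      have h2 : R * dist x y ≤ R * (ε / 3) := by gcongr
      nlinarith
    have hmSh : MeasurableSet Sh := by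
      have m1 : MeasurableSet {y : Euc N | ε * (1 - ε / R) < dist x y} :=
        measurableSet_lt measurable_const (by fun_prop)
      have m2 : MeasurableSet {y : Euc N | dist x y ≤ ε / (1 - ε / R)} :=
        measurableSet_le (by fun_prop) measurable_const
      exact m1.inter m2
    have hrlow : ε / 2 ≤ ε * (1 - ε / R) := by nlinarith
    have hrup : ε / (1 - ε / R) ≤ 2 * ε := by
      rw [div_le_iff₀ h1u]; nlinarith
    have hinv : ∫ y in D, f y = -∫ y in S, f y := setIntegral_inversion hbq hx
    have hShfin : volume Sh < ⊤ := by
      refine (measure_mono fun y hy => ?_).trans_lt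
        (measure_closedBall_lt_top (x := x) (r := ε / (1 - ε / R)))
      rw [mem_closedBall, dist_comm]; exact hy.2
    set M : ℝ := L * ((ε / 2) ^ (1 - q)) with hM
    have hbound : ∀ y ∈ Sh, ‖f y‖ ≤ M := by
      intro y hy
      have hd0 : 0 < dist x y := lt_of_lt_of_le (by positivity) (hrlow.trans hy.1.le)
      have h1 : ‖‖y‖ ^ (-b) - R ^ (-b)‖ ≤ L * dist x y := by
        have := @hLη y (by rw [dist_comm]; linarith [hy.2])
        rwa [← dist_eq_norm, ← dist_eq_norm, dist_comm y x] at this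
      have h1q : 1 - q ≤ 0 := by
        have : (1:ℝ) ≤ N := by exact_mod_cast hN
        linarith
      calc ‖f y‖ = ‖‖y‖ ^ (-b) - R ^ (-b)‖ * dist x y ^ (-q) := by
            rw [hf, norm_mul, Real.norm_of_nonneg (show 0 ≤ dist x y ^ (-q) by positivity)]
        _ ≤ L * dist x y * dist x y ^ (-q) := by gcongr
        _ = L * dist x y ^ (1 - q) := by
            rw [sub_eq_add_neg, Real.rpow_add hd0, Real.rpow_one]; ring
        _ ≤ M := by
            rw [hM]
            refine mul_le_mul_of_nonneg_left ?_ hL0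
            exact Real.rpow_le_rpow_of_nonpos (by positivity) (hrlow.trans hy.1.le) h1q
    have hpt : ∀ y, ‖D.indicator f y - S.indicator f y‖ ≤ Sh.indicator (fun _ => M) y := by
      intro y
      by_cases hy : y ∈ Sh
      · rw [indicator_of_mem hy]
        have hb := hbound y hy
        have hM0 : 0 ≤ M := (norm_nonneg _).trans hb
        by_cases h1 : y ∈ D <;> by_cases h2 : y ∈ S <;> simp [h1, h2] <;>
          first | exact hM0 | simpa using hb
      · rw [indicator_of_notMem hy]
        have hDS : y ∈ D ↔ y ∈ S := by
          refine and_congr_right fun _ => ?_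
          obtain ⟨t1, t2⟩ := htri y
          constructor
          · intro h
            by_contra hc
            push Not at hc
            apply hy
            refine ⟨by nlinarith, ?_⟩
            rw [le_div_iff₀ h1u]
            have : R * dist x y ≤ ε * (R + dist x y) := hc.trans (by gcongr)
            have e : dist x y * (1 - ε / R) = (R * dist x y - ε * dist x y) / R := by
              field_simp
            rw [e, div_le_iff₀ hx0]; linarith
          · intro h
            by_contra hc
            push Not at hc
            apply hy
            refine ⟨?_, ?_⟩
            · have : ε * (R - dist x y) < R * dist x y :=
                lt_of_le_of_lt (by gcongr; linarith) h
              have e : ε * (1 - ε / R) = (ε * (R - ε)) / R := by field_simp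
              rw [e, div_lt_iff₀ hx0]
              nlinarith
            · rw [le_div_iff₀ h1u]
              nlinarith [dist_nonneg (x := x) (y := y)]
        by_cases h1 : y ∈ D
        · simp [h1, hDS.1 h1]
        · have h2 : y ∉ S := fun h => h1 (hDS.2 h)
          simp [h1, h2]
    have h2I : ‖(∫ y in D, f y) - ∫ y in S, f y‖ ≤ M * volume.real Sh := by
      rw [← integral_indicator (hmD ε), ← integral_indicator (hmS ε),
        ← integral_sub (hDi.integrable_indicator (hmD ε)) (hSi.integrable_indicator (hmS ε))]
      refine (norm_integral_le_of_norm_le ?_ (ae_of_all _ hpt)).trans (le_of_eq ?_)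
      · exact (integrableOn_const hShfin.ne).integrable_indicator hmSh
      · rw [integral_indicator hmSh, setIntegral_const, smul_eq_mul, mul_comm]
    have h3 : ‖∫ y in D, f y‖ ≤ M * volume.real Sh := by
      have : (∫ y in D, f y) - ∫ y in S, f y = 2 * ∫ y in D, f y := by linarith
      rw [this, norm_mul] at h2I
      have h4 := norm_nonneg (∫ y in D, f y)
      have : ‖(2:ℝ)‖ = 2 := by norm_num
      rw [this] at h2I
      linarith
    refine h3.trans ?_
    have hM0 : 0 ≤ M := by positivity
    refine (mul_le_mul_of_nonneg_left (measureReal_shell_le x hε0 hεR) hM0).trans (le_of_eq ?_)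
    have e1 : (ε / 2) ^ (1 - q) = (2:ℝ)⁻¹ ^ (1 - q) * ε ^ (1 - q) := by
      rw [div_eq_inv_mul, Real.mul_rpow (by norm_num) hε0.le]
    have e2 : ε ^ (1 - q) * (ε ^ 2 * ε ^ (N - 1)) = ε ^ ((N:ℝ) + 2 - q) := by
      rw [← Real.rpow_natCast, ← Real.rpow_natCast, ← Real.rpow_add hε0, ← Real.rpow_add hε0]
      congr 1; push_cast [hN]; ring
    rw [hM, hCst, e1, mul_pow, ← e2]
    ring
  refine squeeze_zero_norm' hmain ?_
  have h := (Real.continuousAt_rpow_const 0 ((N:ℝ) + 2 - q) (Or.inr (by linarith))).tendsto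
  rw [Real.zero_rpow (by linarith)] at h
  simpa using (h.mono_left nhdsWithin_le_nhds).const_mul Cst

lemma L1mu.integrable {N : ℕ} {s : ℝ} (hs : 0 < s) {v : Euc N → ℝ} (h : L1mu N s v)
    {Ω : Set (Euc N)} (hΩ : IsOpen Ω) {R : ℝ} (hR1 : 1 ≤ R) (hR : ∀ x ∈ Ω, ‖x‖ ≤ R)
    (hout : ∀ x, x ∉ Ω → v x = 0) : Integrable v := by
  have hm : Measurable fun x : Euc N => (1 + ‖x‖) ^ ((N:ℝ) + 2*s) := by fun_prop
  have h1 := Integrable.mul_bdd (c := (1 + R) ^ ((N:ℝ) + 2*s)) h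
    (hm.indicator hΩ.measurableSet).aestronglyMeasurable (ae_of_all _ fun x => by
      by_cases hx : x ∈ Ω
      · rw [indicator_of_mem hx, Real.norm_of_nonneg (by positivity)]
        have := hR x hx
        gcongr
      · rw [indicator_of_notMem hx, norm_zero]
        positivity)
  refine h1.congr (ae_of_all _ fun x => ?_)
  by_cases hx : x ∈ Ω
  · simp only [indicator_of_mem hx]
    rw [mul_assoc, ← Real.rpow_add (by positivity), neg_add_cancel, Real.rpow_zero, mul_one]
  · simp [hout x hx]

lemma le_max_of_rpow_le_mul_add_one {p C M : ℝ} (hp : 1 < p) (hC : 0 ≤ C) (hM : 0 ≤ M)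
    (h : M ^ p ≤ C * (M + 1)) : M ≤ max 1 ((2 * C) ^ (1 / (p - 1))) := by
  rcases le_or_gt M 1 with h1 | h1
  · exact h1.trans (le_max_left _ _)
  refine le_trans ?_ (le_max_right _ _)
  have hM0 : 0 < M := by linarith
  have h2 : M ^ (p - 1) ≤ 2 * C := by
    rw [Real.rpow_sub_one hM0.ne', div_le_iff₀ hM0]
    nlinarith
  rw [one_div, Real.le_rpow_inv_iff_of_pos hM (by positivity) (by linarith)]
  exact h2

set_option maxHeartbeats 400000 in
/-- A first, non-optimal, universal bound near the origin. -/
lemma exists_le_mul_rpow_neg {N : ℕ} (hN : 1 ≤ N) {s p : ℝ} (hs : s ∈ Ioo (0:ℝ) 1)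
    (hp : 1 < p) {Ω : Set (Euc N)} {R : ℝ} (hR1 : 1 ≤ R) (hR : ∀ x ∈ Ω, ‖x‖ ≤ R)
    {v : Euc N → ℝ} (hcont : ContinuousOn v ({(0:Euc N)}ᶜ)) (hv_int : Integrable v)
    (hpos : ∀ x, 0 ≤ v x) (hout : ∀ x, x ∉ Ω → v x = 0)
    (heq : ∀ x ∈ Ω \ {0}, HasFracLap N s v x (-(v x ^ p)))
    {γ : ℝ} (hγ : 0 ≤ γ) (hγ1 : 2 * s ≤ γ * (p - 1)) (hγ2 : (N:ℝ) + 2 * s ≤ γ * p) :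
    ∃ C : ℝ, 0 ≤ C ∧ ∀ x : Euc N, x ≠ 0 → v x ≤ C * ‖x‖ ^ (-γ) := by
  obtain ⟨hs0, hs1⟩ := hs
  set q : ℝ := (N:ℝ) + 2 * s with hq
  have hqN : (N:ℝ) < q := by linarith
  obtain ⟨C₁, hC₁, hsub⟩ := exists_rpow_norm_sub_le N γ hγ
  set I₁ := ∫ z in closedBall (0 : Euc N) 1, ‖z‖ ^ (-(q - 2)) with hI₁
  have hI₁0 : 0 ≤ I₁ := integral_nonneg fun z => by positivity
  set V₁ := ∫ y, v y with hV₁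
  have hV₁0 : 0 ≤ V₁ := integral_nonneg hpos
  have hc := cNs_pos N ⟨hs0, hs1⟩
  set C' : ℝ := cNs N s * (C₁ * I₁ * (2:ℝ)⁻¹ ^ (2 - 2 * s) * R ^ (γ * (p - 1) - 2 * s) +
    (2:ℝ)⁻¹ ^ (-q) * V₁ * R ^ (γ * p - q)) with hC'
  have hC'0 : 0 ≤ C' := by positivity
  set K := max 1 ((2 * C') ^ (1 / (p - 1))) with hK
  have key : ∀ δ, 0 < δ → ∀ x : Euc N, δ < ‖x‖ → (‖x‖ - δ) ^ γ * v x ≤ K := by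
    intro δ hδ x₀ hx₀
    rcases (hpos x₀).eq_or_lt with hv0 | hv0
    · rw [← hv0, mul_zero]; positivity
    set f : Euc N → ℝ := fun y => max (‖y‖ - δ) 0 ^ γ * v y with hf
    have hfx : ∀ y, δ < ‖y‖ → f y = (‖y‖ - δ) ^ γ * v y := by
      intro y hy; simp only [hf, max_eq_left (sub_nonneg.2 hy.le)]
    have hx₀R : ‖x₀‖ ≤ R := hR _ (by by_contra h; exact hv0.ne' (hout _ h))
    set A : Set (Euc N) := closedBall 0 R ∩ {y | δ ≤ ‖y‖} with hA
    have hAc : IsCompact A := (isCompact_closedBall 0 R).inter_right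
      (isClosed_le continuous_const continuous_norm)
    have hfc : ContinuousOn f A := by
      refine ContinuousOn.mul (ContinuousOn.rpow_const (by fun_prop) fun _ _ => Or.inr hγ)
        (hcont.mono fun y hy => ?_)
      have : 0 < ‖y‖ := hδ.trans_le hy.2
      simpa using this
    obtain ⟨x, hxA, hmax⟩ := hAc.exists_isMaxOn ⟨x₀, by simpa using hx₀R, hx₀.le⟩ hfc
    have hfx₀ : 0 < f x₀ := by
      rw [hfx _ hx₀]
      exact mul_pos (Real.rpow_pos_of_pos (by linarith) _) hv0
    have hmax' : ∀ y, δ < ‖y‖ → (‖y‖ - δ) ^ γ * v y ≤ f x := by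
      intro y hy
      by_cases hyΩ : y ∈ Ω
      · rw [← hfx y hy]
        exact hmax ⟨by simpa using hR y hyΩ, hy.le⟩
      · rw [hout y hyΩ, mul_zero]
        exact hfx₀.le.trans (hmax ⟨by simpa using hx₀R, hx₀.le⟩)
    have hfx0 : 0 < f x := hfx₀.trans_le (hmax ⟨by simpa using hx₀R, hx₀.le⟩)
    have hvx : 0 < v x := (hpos x).lt_of_ne fun h => by simp [hf, ← h] at hfx0
    have hxΩ : x ∈ Ω := by by_contra h; exact hvx.ne' (hout _ h)
    have hδx : δ ≤ ‖x‖ := hxA.2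
    have hx0 : x ≠ 0 := norm_pos_iff.1 (hδ.trans_le hδx)
    have hp1 : γ ≠ 0 := by rintro rfl; linarith
    have hδx' : δ < ‖x‖ := hδx.lt_of_ne fun h => by
      simp [hf, ← h, Real.zero_rpow hp1] at hfx0
    set d := ‖x‖ - δ with hd
    have hd0 : 0 < d := by linarith
    have hdR : d ≤ R := by linarith [hR x hxΩ]
    rw [hfx x hδx'] at hmax'
    refine (hmax' x₀ hx₀).trans ?_
    set M := d ^ γ * v x with hM
    have hM0 : 0 < M := by positivity
    refine le_max_of_rpow_le_mul_add_one hp hC'0 hM0.le ?_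
    set a : Euc N := v x • (-(γ / (d * ‖x‖)) • x) with ha
    set B : ℝ := v x * (C₁ / d ^ 2) with hB
    have hB0 : 0 ≤ B := by positivity
    have hquad : ∀ z : Euc N, ‖z‖ ≤ d / 2 → v (x + z) - v x ≤ inner ℝ a z + B * ‖z‖ ^ 2 := by
      intro z hz
      obtain ⟨h1, h2⟩ := hsub x z δ d hδ.le hd0 (by linarith) hz
      have h3 := hmax' (x + z) (by linarith)
      have h4 : v (x + z) ≤ M * (‖x + z‖ - δ) ^ (-γ) := by
        rw [Real.rpow_neg h1.le, ← div_eq_mul_inv, le_div_iff₀ (Real.rpow_pos_of_pos h1 _)]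
        linarith
      have h5 : M * d ^ (-γ) = v x := by
        rw [hM, Real.rpow_neg hd0.le]; field_simp
      have h6 := h4.trans (mul_le_mul_of_nonneg_left h2 hM0.le)
      rw [← mul_assoc, h5] at h6
      rw [ha, inner_smul_left]
      simp only [conj_trivial, hB]
      linarith
    have hL : v x ^ p ≤ cNs N s * (B * (I₁ * (d / 2) ^ ((N:ℝ) + 2 - q)) +
        (d / 2) ^ (-q) * V₁) := by
      refine le_of_hasFracLap ⟨hs0, hs1⟩ (heq x ⟨hxΩ, hx0⟩)
        (A := fun _ => B * (I₁ * (d / 2) ^ ((N:ℝ) + 2 - q)) + (d / 2) ^ (-q) * V₁)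
        tendsto_const_nhds ?_
      have hev : ∀ᶠ ε in 𝓝[>] (0:ℝ), ε < d / 2 :=
        eventually_nhdsWithin_of_eventually_nhds (eventually_lt_nhds (by positivity))
      filter_upwards [hev, self_mem_nhdsWithin] with ε hε (hε0 : 0 < ε)
      refine (setIntegral_le_of_le_quadratic hN (q := q) (by linarith) hB0 hε0 hε hquad
        (integrableOn_sub_mul_tail hN hqN hv_int x hε0).1).trans ?_
      gcongr
      have hi := integrableOn_sub_mul_tail hN hqN hv_int x (show 0 < d / 2 by positivity)
      have hVi : Integrable (fun z => v (x + z)) := hv_int.comp_add_left x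
      calc ∫ z in {z : Euc N | d / 2 < ‖z‖}, (v (x + z) - v x) * ‖z‖ ^ (-q)
          ≤ ∫ z in {z : Euc N | d / 2 < ‖z‖}, (d / 2) ^ (-q) * v (x + z) := by
            refine setIntegral_mono_on hi.1 (hVi.const_mul _).integrableOn
              (measurableSet_norm_gt _) fun z hz => ?_
            have h1 : ‖z‖ ^ (-q) ≤ (d / 2) ^ (-q) :=
              Real.rpow_le_rpow_of_nonpos (by positivity) (le_of_lt hz)
                (by have : (0:ℝ) ≤ N := by positivity
                    linarith)
            have h2 : 0 ≤ ‖z‖ ^ (-q) := by positivity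
            nlinarith [hpos (x + z)]
        _ ≤ ∫ z, (d / 2) ^ (-q) * v (x + z) :=
            setIntegral_le_integral (hVi.const_mul _)
              (ae_of_all _ fun z => mul_nonneg (by positivity) (hpos _))
        _ = (d / 2) ^ (-q) * V₁ := by
            rw [integral_const_mul, integral_add_left_eq_self]
    clear_value C' K q I₁ V₁ d M B a
    have e1 : (d / 2) ^ ((N:ℝ) + 2 - q) = (2:ℝ)⁻¹ ^ (2 - 2 * s) * d ^ (2 - 2 * s) := by
      rw [div_eq_inv_mul, Real.mul_rpow (by norm_num) hd0.le, hq]; ring_nf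
    have e2 : (d / 2) ^ (-q) = (2:ℝ)⁻¹ ^ (-q) * d ^ (-q) := by
      rw [div_eq_inv_mul, Real.mul_rpow (by norm_num) hd0.le]
    have e3 : M ^ p = d ^ (γ * p) * v x ^ p := by
      rw [hM, Real.mul_rpow (by positivity) hvx.le, ← Real.rpow_mul hd0.le]
    have e4 : d ^ (γ * p) * (v x * (1 / d ^ 2) * d ^ (2 - 2 * s)) =
        M * d ^ (γ * (p - 1) - 2 * s) := by
      rw [hM, one_div, ← Real.rpow_natCast, ← Real.rpow_neg hd0.le]
      have : d ^ (γ * p) * d ^ (-((2:ℕ):ℝ)) * d ^ (2 - 2 * s) =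
          d ^ γ * d ^ (γ * (p - 1) - 2 * s) := by
        rw [← Real.rpow_add hd0, ← Real.rpow_add hd0, ← Real.rpow_add hd0]
        congr 1; push_cast; ring
      linear_combination v x * this
    have e5 : d ^ (γ * p) * d ^ (-q) = d ^ (γ * p - q) := by
      rw [← Real.rpow_add hd0]; ring_nf
    have h1 : d ^ (γ * (p - 1) - 2 * s) ≤ R ^ (γ * (p - 1) - 2 * s) :=
      Real.rpow_le_rpow hd0.le hdR (by linarith)
    have h2 : d ^ (γ * p - q) ≤ R ^ (γ * p - q) := Real.rpow_le_rpow hd0.le hdR (by linarith)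
    calc M ^ p ≤ d ^ (γ * p) * (cNs N s * (B * (I₁ * (d / 2) ^ ((N:ℝ) + 2 - q)) +
          (d / 2) ^ (-q) * V₁)) := by
          rw [e3]
          exact mul_le_mul_of_nonneg_left hL (by positivity)
      _ = cNs N s * (C₁ * I₁ * (2:ℝ)⁻¹ ^ (2 - 2 * s) * d ^ (γ * (p - 1) - 2 * s) * M +
          (2:ℝ)⁻¹ ^ (-q) * V₁ * d ^ (γ * p - q)) := by
          rw [e1, e2, hB]
          linear_combination cNs N s * C₁ * I₁ * (2:ℝ)⁻¹ ^ (2 - 2 * s) * e4 +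
            cNs N s * (2:ℝ)⁻¹ ^ (-q) * V₁ * e5
      _ ≤ cNs N s * (C₁ * I₁ * (2:ℝ)⁻¹ ^ (2 - 2 * s) * R ^ (γ * (p - 1) - 2 * s) * M +
          (2:ℝ)⁻¹ ^ (-q) * V₁ * R ^ (γ * p - q)) :=
          mul_le_mul_of_nonneg_left (add_le_add
            (mul_le_mul_of_nonneg_right (mul_le_mul_of_nonneg_left h1 (by positivity)) hM0.le)
            (mul_le_mul_of_nonneg_left h2 (by positivity))) hc.le
      _ ≤ C' * (M + 1) := by
          have t1 : 0 ≤ cNs N s * (C₁ * I₁ * (2:ℝ)⁻¹ ^ (2 - 2 * s) *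
            R ^ (γ * (p - 1) - 2 * s)) := by positivity
          have t2 : 0 ≤ cNs N s * ((2:ℝ)⁻¹ ^ (-q) * V₁ * R ^ (γ * p - q)) * M := by positivity
          rw [hC']
          linarith
  refine ⟨K, by positivity, fun x hx => ?_⟩
  have hx0 : 0 < ‖x‖ := norm_pos_iff.2 hx
  rw [Real.rpow_neg hx0.le, ← div_eq_mul_inv, le_div_iff₀ (by positivity), mul_comm]
  have hT : Tendsto (fun δ : ℝ => (‖x‖ - δ) ^ γ * v x) (𝓝[>] 0) (𝓝 (‖x‖ ^ γ * v x)) := by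
    have : ContinuousAt (fun δ : ℝ => (‖x‖ - δ) ^ γ * v x) 0 :=
      ((continuousAt_const.sub continuousAt_id).rpow_const (Or.inr hγ)).mul continuousAt_const
    have h := this.tendsto
    rw [sub_zero] at h
    exact h.mono_left nhdsWithin_le_nhds
  refine le_of_tendsto hT ?_
  have hev : ∀ᶠ δ in 𝓝[>] (0:ℝ), δ < ‖x‖ :=
    eventually_nhdsWithin_of_eventually_nhds (eventually_lt_nhds hx0)
  filter_upwards [hev, self_mem_nhdsWithin] with δ hδ (hδ0 : 0 < δ)
  exact key δ hδ0 x hδ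

lemma setIntegral_sub_le_of_le_barrier {N : ℕ} (hN : 1 ≤ N) {q : ℝ} (hq : (N:ℝ) < q)
    {v : Euc N → ℝ} (hv_int : Integrable v) {x : Euc N} {W : Euc N → ℝ} {ε : ℝ} (hε : 0 < ε)
    (hW : IntegrableOn (fun z => W z * ‖z‖ ^ (-q)) {z | ε < ‖z‖})
    (h : ∀ z, x + z ≠ 0 → v (x + z) - v x ≤ W z) :
    ∫ z in {z : Euc N | ε < ‖z‖}, (v (x + z) - v x) * ‖z‖ ^ (-q) ≤
      ∫ z in {z : Euc N | ε < ‖z‖}, W z * ‖z‖ ^ (-q) := by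
  have := euc_nontrivial hN
  refine setIntegral_mono_ae (integrableOn_sub_mul_tail hN hq hv_int x hε).1 hW ?_
  have h0 : ∀ᵐ z : Euc N, z ≠ -x := by simp [ae_iff]
  filter_upwards [h0] with z hz
  exact mul_le_mul_of_nonneg_right (h z fun h => hz (eq_neg_of_add_eq_zero_right h))
    (by positivity)

set_option maxHeartbeats 400000 in
/-- Improvement to the growth rate of the fundamental solution. -/
lemma exists_le_mul_rpow_neg_of_le {N : ℕ} (hN : 1 ≤ N) {s p : ℝ} (hs : s ∈ Ioo (0:ℝ) 1)
    (hp : 1 < p) {Ω : Set (Euc N)} {R : ℝ} (hR1 : 1 ≤ R) (hR : ∀ x ∈ Ω, ‖x‖ ≤ R)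
    {v : Euc N → ℝ} (hcont : ContinuousOn v ({(0:Euc N)}ᶜ)) (hv_int : Integrable v)
    (hpos : ∀ x, 0 ≤ v x) (hout : ∀ x, x ∉ Ω → v x = 0)
    (heq : ∀ x ∈ Ω \ {0}, HasFracLap N s v x (-(v x ^ p)))
    {γ τ b C₀ : ℝ} (hγ : 0 ≤ γ) (hγτ : γ < τ) (hτ : τ < N) (hb : 0 ≤ b) (hbN : b < N)
    (hbp : 2 * s ≤ b * (p - 1)) (hC₀ : 0 ≤ C₀)
    (hv : ∀ x : Euc N, x ≠ 0 → v x ≤ C₀ * ‖x‖ ^ (-γ)) :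
    ∃ C : ℝ, 0 ≤ C ∧ ∀ x : Euc N, x ≠ 0 → v x ≤ C * ‖x‖ ^ (-b) := by
  have hs0 := hs.1
  have hs1 := hs.2
  have hc := cNs_pos N hs
  obtain ⟨Cb, hCb, htb⟩ := exists_truncated_rpow_norm_le hN (q := (N:ℝ) + 2 * s) (by linarith)
    (by linarith) hb hbN
  obtain ⟨Cτ, hCτ, htτ⟩ := exists_truncated_rpow_norm_le hN (q := (N:ℝ) + 2 * s) (by linarith)
    (by linarith) (hγ.trans hγτ.le) hτ
  set C := cNs N s * (Cb + Cτ) * R ^ (b * (p - 1) - 2 * s) with hC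
  have hC0 : 0 ≤ C := by positivity
  set K₀ := C ^ (p - 1)⁻¹ with hK₀
  have hK₀0 : 0 ≤ K₀ := by positivity
  have key : ∀ κ, 0 < κ → ∀ x : Euc N, x ≠ 0 →
      v x ≤ K₀ * (‖x‖ ^ (-b) + κ * ‖x‖ ^ (-τ)) := by
    intro κ hκ x₀ hx₀
    set W : Euc N → ℝ := fun x => ‖x‖ ^ (-b) + κ * ‖x‖ ^ (-τ) with hW
    have hW0 : ∀ x : Euc N, x ≠ 0 → 0 < W x := by
      intro x hx
      have := norm_pos_iff.2 hx
      simp only [hW]; positivity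
    change v x₀ ≤ K₀ * W x₀
    rcases (hpos x₀).eq_or_lt with hv0 | hv0
    · rw [← hv0]; exact mul_nonneg hK₀0 (hW0 _ hx₀).le
    have hn0 : 0 < ‖x₀‖ := norm_pos_iff.2 hx₀
    set f : Euc N → ℝ := fun x => v x / W x with hf
    have hfx₀ : 0 < f x₀ := div_pos hv0 (hW0 _ hx₀)
    have hfle : ∀ x : Euc N, x ≠ 0 → f x ≤ C₀ / κ * ‖x‖ ^ (τ - γ) := by
      intro x hx
      have hxp := norm_pos_iff.2 hx
      rw [hf, div_le_iff₀ (hW0 x hx)]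
      refine (hv x hx).trans ?_
      have e : C₀ * ‖x‖ ^ (-γ) = C₀ / κ * ‖x‖ ^ (τ - γ) * (κ * ‖x‖ ^ (-τ)) := by
        have : ‖x‖ ^ (-γ) = ‖x‖ ^ (τ - γ) * ‖x‖ ^ (-τ) := by
          rw [← Real.rpow_add hxp]; ring_nf
        rw [this]; field_simp
      rw [e]
      refine mul_le_mul_of_nonneg_left ?_ (by positivity)
      simp only [hW]
      linarith [Real.rpow_nonneg hxp.le (-b)]
    obtain ⟨r, hr0, hrx, hr⟩ : ∃ r, 0 < r ∧ r ≤ ‖x₀‖ ∧ C₀ / κ * r ^ (τ - γ) < f x₀ := by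
      have hT : Tendsto (fun r : ℝ => C₀ / κ * r ^ (τ - γ)) (𝓝[>] 0) (𝓝 0) := by
        have h := (Real.continuousAt_rpow_const 0 (τ - γ) (Or.inr (by linarith))).tendsto
        rw [Real.zero_rpow (by linarith)] at h
        simpa using (h.mono_left nhdsWithin_le_nhds).const_mul (C₀ / κ)
      have hev : ∀ᶠ r in 𝓝[>] (0:ℝ), r < ‖x₀‖ :=
        eventually_nhdsWithin_of_eventually_nhds (eventually_lt_nhds hn0)
      obtain ⟨r, h1, h2, h3⟩ :=
        ((hT.eventually (eventually_lt_nhds hfx₀)).and (hev.and self_mem_nhdsWithin)).exists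
      exact ⟨r, h3, h2.le, h1⟩
    have hx₀R : ‖x₀‖ ≤ R := hR _ (by by_contra h; exact hv0.ne' (hout _ h))
    set A : Set (Euc N) := closedBall 0 R ∩ {y | r ≤ ‖y‖} with hA
    have hAc : IsCompact A := (isCompact_closedBall 0 R).inter_right
      (isClosed_le continuous_const continuous_norm)
    have hA0 : ∀ y ∈ A, y ≠ 0 := fun y hy => norm_pos_iff.1 (hr0.trans_le hy.2)
    have hfc : ContinuousOn f A := by
      refine ContinuousOn.div (hcont.mono fun y hy => by simpa using hA0 y hy) ?_
        fun y hy => (hW0 y (hA0 y hy)).ne'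
      exact (continuousOn_id.norm.rpow_const fun y hy => Or.inl (norm_ne_zero_iff.2 (hA0 y hy))).add
        (continuousOn_const.mul
          (continuousOn_id.norm.rpow_const fun y hy => Or.inl (norm_ne_zero_iff.2 (hA0 y hy))))
    have hx₀A : x₀ ∈ A := ⟨by simpa using hx₀R, hrx⟩
    obtain ⟨x, hxA, hmax⟩ := hAc.exists_isMaxOn ⟨x₀, hx₀A⟩ hfc
    set K := f x with hK
    have hK0 : 0 < K := hfx₀.trans_le (hmax hx₀A)
    have hvK : ∀ y : Euc N, y ≠ 0 → v y ≤ K * W y := by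
      intro y hy
      rw [← div_le_iff₀ (hW0 y hy)]
      change f y ≤ K
      by_cases hyΩ : y ∈ Ω
      · rcases le_or_gt r ‖y‖ with h | h
        · exact hmax ⟨by simpa using hR y hyΩ, h⟩
        · refine (hfle y hy).trans ((lt_of_le_of_lt ?_ hr).le.trans (hmax hx₀A))
          gcongr
      · simp only [hf, hout y hyΩ, zero_div]; exact hK0.le
    have hx0 : x ≠ 0 := hA0 x hxA
    have hxp := norm_pos_iff.2 hx0
    have hWx := hW0 x hx0
    have hvx : v x = K * W x := by rw [hK, hf]; field_simp
    have hvx0 : 0 < v x := by rw [hvx]; positivity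
    have hxΩ : x ∈ Ω := by by_contra h; exact hvx0.ne' (hout _ h)
    have hxR : ‖x‖ ≤ R := hR x hxΩ
    refine (hvK x₀ hx₀).trans (mul_le_mul_of_nonneg_right ?_ (hW0 x₀ hx₀).le)
    have hL : v x ^ p ≤ cNs N s * (K * (Cb * ‖x‖ ^ (-b - 2 * s)) +
        K * κ * (Cτ * ‖x‖ ^ (-τ - 2 * s))) := by
      refine le_of_hasFracLap hs (heq x ⟨hxΩ, hx0⟩)
        (A := fun _ => K * (Cb * ‖x‖ ^ (-b - 2 * s)) + K * κ * (Cτ * ‖x‖ ^ (-τ - 2 * s)))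
        tendsto_const_nhds ?_
      have hev : ∀ᶠ ε in 𝓝[>] (0:ℝ), ε < ‖x‖ / 2 :=
        eventually_nhdsWithin_of_eventually_nhds (eventually_lt_nhds (by positivity))
      filter_upwards [hev, self_mem_nhdsWithin] with ε hε (hε0 : 0 < ε)
      have i1 := (integrableOn_rpow_norm_sub hN (q := (N:ℝ) + 2 * s) (by linarith) hb hbN x
        hε0).const_mul K
      have i2 := (integrableOn_rpow_norm_sub hN (q := (N:ℝ) + 2 * s) (by linarith)
        (hγ.trans hγτ.le) hτ x hε0).const_mul (K * κ)
      have e : ∀ z : Euc N, (K * (‖x + z‖ ^ (-b) - ‖x‖ ^ (-b)) +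
          K * κ * (‖x + z‖ ^ (-τ) - ‖x‖ ^ (-τ))) * ‖z‖ ^ (-((N:ℝ) + 2 * s)) =
          K * ((‖x + z‖ ^ (-b) - ‖x‖ ^ (-b)) * ‖z‖ ^ (-((N:ℝ) + 2 * s))) +
          K * κ * ((‖x + z‖ ^ (-τ) - ‖x‖ ^ (-τ)) * ‖z‖ ^ (-((N:ℝ) + 2 * s))) :=
        fun z => by ring
      refine (setIntegral_sub_le_of_le_barrier hN (q := (N:ℝ) + 2 * s) (by linarith) hv_int hε0
        (W := fun z => K * (‖x + z‖ ^ (-b) - ‖x‖ ^ (-b)) +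
          K * κ * (‖x + z‖ ^ (-τ) - ‖x‖ ^ (-τ))) ?_ fun z hz => ?_).trans ?_
      · simp only [e]; exact i1.add i2
      · have := hvK (x + z) hz
        rw [hvx]
        simp only [hW] at this ⊢
        linarith
      · simp only [e]
        rw [integral_add i1 i2, integral_const_mul, integral_const_mul]
        have h1 := htb x hx0 ε hε0 hε
        have h2 := htτ x hx0 ε hε0 hε
        rw [show -b + (N:ℝ) - ((N:ℝ) + 2 * s) = -b - 2 * s by ring] at h1
        rw [show -τ + (N:ℝ) - ((N:ℝ) + 2 * s) = -τ - 2 * s by ring] at h2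
        exact add_le_add (mul_le_mul_of_nonneg_left h1 hK0.le)
          (mul_le_mul_of_nonneg_left h2 (by positivity))
    have hWdef : W x = ‖x‖ ^ (-b) + κ * ‖x‖ ^ (-τ) := rfl
    clear_value K W A C K₀
    have hbW : ‖x‖ ^ (-b) ≤ W x := by
      rw [hWdef]
      have : 0 ≤ κ * ‖x‖ ^ (-τ) := by positivity
      linarith
    have h1 : v x ^ p ≤ cNs N s * (Cb + Cτ) * ‖x‖ ^ (-(2 * s)) * v x := by
      refine hL.trans ?_
      have e1 : ‖x‖ ^ (-b - 2 * s) = ‖x‖ ^ (-(2 * s)) * ‖x‖ ^ (-b) := by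
        rw [← Real.rpow_add hxp]; ring_nf
      have e2 : ‖x‖ ^ (-τ - 2 * s) = ‖x‖ ^ (-(2 * s)) * ‖x‖ ^ (-τ) := by
        rw [← Real.rpow_add hxp]; ring_nf
      rw [e1, e2, hvx, hWdef]
      have t1 : 0 ≤ cNs N s * K * Cb * ‖x‖ ^ (-(2 * s)) * (κ * ‖x‖ ^ (-τ)) := by positivity
      have t2 : 0 ≤ cNs N s * K * Cτ * ‖x‖ ^ (-(2 * s)) * ‖x‖ ^ (-b) := by positivity
      linarith
    have h2 : v x ^ (p - 1) ≤ cNs N s * (Cb + Cτ) * ‖x‖ ^ (-(2 * s)) := by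
      rw [Real.rpow_sub_one hvx0.ne', div_le_iff₀ hvx0]; exact h1
    have h3 : (K * ‖x‖ ^ (-b)) ^ (p - 1) ≤ cNs N s * (Cb + Cτ) * ‖x‖ ^ (-(2 * s)) := by
      refine le_trans ?_ h2
      rw [hvx]
      exact Real.rpow_le_rpow (by positivity) (mul_le_mul_of_nonneg_left hbW hK0.le)
        (by linarith)
    rw [hK₀, Real.le_rpow_inv_iff_of_pos hK0.le hC0 (by linarith)]
    rw [Real.mul_rpow hK0.le (by positivity), ← Real.rpow_mul hxp.le] at h3
    have e3 : K ^ (p - 1) = K ^ (p - 1) * ‖x‖ ^ (-b * (p - 1)) * ‖x‖ ^ (b * (p - 1)) := by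
      rw [mul_assoc, ← Real.rpow_add hxp, show -b * (p - 1) + b * (p - 1) = 0 by ring,
        Real.rpow_zero, mul_one]
    have e4 : ‖x‖ ^ (-(2 * s)) * ‖x‖ ^ (b * (p - 1)) = ‖x‖ ^ (b * (p - 1) - 2 * s) := by
      rw [← Real.rpow_add hxp]; ring_nf
    rw [e3]
    refine (mul_le_mul_of_nonneg_right h3 (by positivity)).trans ?_
    rw [mul_assoc, e4, hC]
    exact mul_le_mul_of_nonneg_left (Real.rpow_le_rpow hxp.le hxR (by linarith)) (by positivity)
  refine ⟨K₀, hK₀0, fun x hx => ?_⟩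
  have hT : Tendsto (fun κ : ℝ => K₀ * (‖x‖ ^ (-b) + κ * ‖x‖ ^ (-τ))) (𝓝[>] 0)
      (𝓝 (K₀ * ‖x‖ ^ (-b))) := by
    have : Continuous (fun κ : ℝ => K₀ * (‖x‖ ^ (-b) + κ * ‖x‖ ^ (-τ))) := by fun_prop
    have h := this.tendsto 0
    rw [zero_mul, add_zero] at h
    exact h.mono_left nhdsWithin_le_nhds
  refine ge_of_tendsto hT ?_
  filter_upwards [self_mem_nhdsWithin] with κ (hκ : 0 < κ)
  exact key κ hκ x hx

set_option maxHeartbeats 400000 in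
/-- If the optimal constant `K` in `v ≤ K ‖x‖ ^ (2s - N)` is almost attained, a perturbed
comparison with the fundamental solution bounds `K`. -/
lemma exists_rpow_le_mul_of_le_fundamental {N : ℕ} (hN : 1 ≤ N) {s p : ℝ} (hs : s ∈ Ioo (0:ℝ) 1)
    (hp : 1 < p) {Ω : Set (Euc N)} {R : ℝ} (hR1 : 1 ≤ R) (hR : ∀ x ∈ Ω, ‖x‖ ≤ R)
    {v : Euc N → ℝ} (hcont : ContinuousOn v ({(0:Euc N)}ᶜ)) (hv_int : Integrable v)
    (hout : ∀ x, x ∉ Ω → v x = 0)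
    (heq : ∀ x ∈ Ω \ {0}, HasFracLap N s v x (-(v x ^ p)))
    {b : ℝ} (hb : 0 ≤ b) (hbN : b = (N:ℝ) - 2 * s) (hbp : (N:ℝ) ≤ b * p) :
    ∃ C : ℝ, 0 ≤ C ∧ ∀ K m η : ℝ, 0 < m → 0 < η → η ≤ m →
      2 * m = K * (3 / 2 : ℝ) ^ (-b) →
      (∀ x : Euc N, x ≠ 0 → v x ≤ K * ‖x‖ ^ (-b)) →
      (∃ x : Euc N, x ≠ 0 ∧ (K - η) * ‖x‖ ^ (-b) < v x) → m ^ p ≤ C * η := by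
  have hs0 := hs.1
  have hs1 := hs.2
  have hc := cNs_pos N hs
  set q : ℝ := (N:ℝ) + 2 * s with hq
  have hqN : (N:ℝ) < q := by linarith
  set I₁ := ∫ z in closedBall (0 : Euc N) 1, ‖z‖ ^ (-(q - 2)) with hI₁
  have hI₁0 : 0 ≤ I₁ := integral_nonneg fun z => by positivity
  set I₃ := ∫ z in {z : Euc N | 1 < ‖z‖}, ‖z‖ ^ (-q) with hI₃
  have hI₃0 : 0 ≤ I₃ := integral_nonneg fun z => by positivity
  refine ⟨cNs N s * (I₁ + I₃) * (2:ℝ)⁻¹ ^ (-(2 * s)) * R ^ (b * p - N), by positivity, ?_⟩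
  rintro K m η hm hη hηm hmK hvK ⟨x₀, hx₀, hvx₀⟩
  have h32 : (3 / 2 : ℝ) ^ (-b) ≤ 1 :=
    Real.rpow_le_one_of_one_le_of_nonpos (by norm_num) (by linarith)
  have h32p : 0 < (3 / 2 : ℝ) ^ (-b) := by positivity
  have hK0 : 0 < K := by
    by_contra h
    push Not at h
    nlinarith
  have hηK : η < K := by nlinarith
  set r := ‖x₀‖ with hr
  have hr0 : 0 < r := norm_pos_iff.2 hx₀
  set ρ := r / 2 with hρ
  have hρ0 : 0 < ρ := by positivity
  have hx₀Ω : x₀ ∈ Ω := by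
    by_contra h
    rw [hout _ h] at hvx₀
    have : 0 < (K - η) * r ^ (-b) := mul_pos (by linarith) (by positivity)
    linarith
  have hrR : r ≤ R := hR _ hx₀Ω
  set h₀ := η * r ^ (-b) with hh₀
  have hh₀0 : 0 < h₀ := by positivity
  set β : Euc N → ℝ := fun y => h₀ * max (1 - ‖y - x₀‖ ^ 2 / ρ ^ 2) 0 with hβ
  have hβc : Continuous β := by fun_prop
  have hβ0 : ∀ y, 0 ≤ β y := fun y => mul_nonneg hh₀0.le (le_max_right _ _)
  have hβle : ∀ y, β y ≤ h₀ := fun y => by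
    refine mul_le_of_le_one_right hh₀0.le (max_le ?_ zero_le_one)
    have : 0 ≤ ‖y - x₀‖ ^ 2 / ρ ^ 2 := by positivity
    linarith
  have hβout : ∀ y, ρ < ‖y - x₀‖ → β y = 0 := fun y hy => by
    have : 1 ≤ ‖y - x₀‖ ^ 2 / ρ ^ 2 := by
      rw [one_le_div (by positivity)]; gcongr
    simp only [hβ]
    rw [max_eq_right (by linarith), mul_zero]
  set g : Euc N → ℝ := fun y => K * ‖y‖ ^ (-b) - v y - β y with hg
  have hball : ∀ y ∈ closedBall x₀ ρ, 0 < ‖y‖ ∧ ‖y‖ ≤ 3 / 2 * r := by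
    intro y hy
    rw [mem_closedBall, dist_eq_norm] at hy
    have h1 := norm_sub_norm_le x₀ y
    have h2 := norm_sub_norm_le y x₀
    rw [norm_sub_rev] at h1
    constructor <;> linarith
  have hgc : ContinuousOn g (closedBall x₀ ρ) := by
    have h0 : ∀ y ∈ closedBall x₀ ρ, y ≠ 0 := fun y hy => norm_pos_iff.1 (hball y hy).1
    refine ((continuousOn_const.mul (continuousOn_id.norm.rpow_const fun y hy =>
      Or.inl (norm_ne_zero_iff.2 (h0 y hy)))).sub (hcont.mono fun y hy => ?_)).sub
      hβc.continuousOn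
    simpa using h0 y hy
  obtain ⟨x, hxB, hmin⟩ := (isCompact_closedBall x₀ ρ).exists_isMinOn
    ⟨x₀, mem_closedBall_self hρ0.le⟩ hgc
  obtain ⟨hxp, hxr⟩ := hball x hxB
  have hx0 : x ≠ 0 := norm_pos_iff.1 hxp
  have hgx : g x < 0 := by
    refine lt_of_le_of_lt (hmin (mem_closedBall_self hρ0.le)) ?_
    simp only [hg, hβ, sub_self, norm_zero]
    norm_num
    rw [← hr, hh₀]
    linarith
  have hgle : ∀ y : Euc N, y ≠ 0 → g x ≤ g y := by
    intro y hy
    by_cases hyB : y ∈ closedBall x₀ ρ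
    · exact hmin hyB
    · rw [mem_closedBall, dist_eq_norm, not_le] at hyB
      have := hvK y hy
      have h2 : g y = K * ‖y‖ ^ (-b) - v y - β y := rfl
      rw [hβout y hyB] at h2
      linarith
  have hgxe : g x = K * ‖x‖ ^ (-b) - v x - β x := rfl
  have hβx : 0 < β x := by
    have := hvK x hx0
    linarith
  have hβxe : β x = h₀ * (1 - ‖x - x₀‖ ^ 2 / ρ ^ 2) := by
    simp only [hβ] at hβx ⊢
    congr 1
    refine max_eq_left (le_of_not_gt fun h => ?_)
    rw [max_eq_right h.le, mul_zero] at hβx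
    exact lt_irrefl _ hβx
  have hvxm : m * r ^ (-b) ≤ v x := by
    have h1 : (3 / 2 : ℝ) ^ (-b) * r ^ (-b) ≤ ‖x‖ ^ (-b) := by
      rw [← Real.mul_rpow (by norm_num) hr0.le]
      exact Real.rpow_le_rpow_of_nonpos hxp hxr (by linarith)
    have h2 := hβle x
    have h3 : K * ((3 / 2 : ℝ) ^ (-b) * r ^ (-b)) ≤ K * ‖x‖ ^ (-b) := by gcongr
    rw [← mul_assoc, ← hmK] at h3
    have h4 : h₀ ≤ m * r ^ (-b) := by rw [hh₀]; gcongr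
    linarith
  have hvx0 : 0 < v x := lt_of_lt_of_le (by positivity) hvxm
  have hxΩ : x ∈ Ω := by by_contra h; exact hvx0.ne' (hout _ h)
  have hbump : ∀ z : Euc N, ‖z‖ ≤ ρ →
      β x - β (x + z) ≤ inner ℝ ((h₀ * 2 / ρ ^ 2) • (x - x₀)) z + h₀ / ρ ^ 2 * ‖z‖ ^ 2 := by
    intro z _
    have h1 : h₀ * (1 - ‖x + z - x₀‖ ^ 2 / ρ ^ 2) ≤ β (x + z) :=
      mul_le_mul_of_nonneg_left (le_max_left _ _) hh₀0.le
    have h2 : ‖x + z - x₀‖ ^ 2 = ‖x - x₀‖ ^ 2 + 2 * inner ℝ (x - x₀) z + ‖z‖ ^ 2 := by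
      rw [show x + z - x₀ = (x - x₀) + z by abel, norm_add_sq_real]
    rw [h2] at h1
    rw [hβxe, inner_smul_left]
    simp only [conj_trivial]
    refine (sub_le_sub_left h1 _).trans (le_of_eq ?_)
    ring
  have hβi : ∀ ε, 0 < ε →
      IntegrableOn (fun z => (β x - β (x + z)) * ‖z‖ ^ (-q)) {z | ε < ‖z‖} := by
    intro ε hε
    refine (integrableOn_rpow_norm_tail hN hqN hε).bdd_mul (c := h₀)
      (Continuous.aestronglyMeasurable (by fun_prop)) (ae_of_all _ fun z => ?_)
    rw [Real.norm_eq_abs, abs_le]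
    constructor <;> linarith [hβ0 x, hβ0 (x + z), hβle x, hβle (x + z)]
  have hfar : ∫ z in {z : Euc N | ρ < ‖z‖}, (β x - β (x + z)) * ‖z‖ ^ (-q) ≤
      h₀ * (I₃ * ρ ^ ((N:ℝ) - q)) := by
    rw [← setIntegral_rpow_norm_tail q hρ0, ← integral_const_mul]
    refine setIntegral_mono_on (hβi ρ hρ0)
      ((integrableOn_rpow_norm_tail hN hqN hρ0).const_mul _) (measurableSet_norm_gt _)
      fun z _ => mul_le_mul_of_nonneg_right ?_ (by positivity)
    linarith [hβ0 (x + z), hβle x]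
  set E := h₀ / ρ ^ 2 * (I₁ * ρ ^ ((N:ℝ) + 2 - q)) + h₀ * (I₃ * ρ ^ ((N:ℝ) - q)) with hE
  have hL : v x ^ p ≤ cNs N s * (K * 0 + E) := by
    refine le_of_hasFracLap hs (heq x ⟨hxΩ, hx0⟩)
      (((tendsto_truncated_fundamental hN (b := b) (q := q) (by rw [hbN, hq]; ring) hb hqN
        (by linarith) hx0).const_mul K).add_const E) ?_
    have hev : ∀ᶠ ε in 𝓝[>] (0:ℝ), ε < ρ :=
      eventually_nhdsWithin_of_eventually_nhds (eventually_lt_nhds hρ0)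
    filter_upwards [hev, self_mem_nhdsWithin] with ε hε (hε0 : 0 < ε)
    have i1 := (integrableOn_rpow_norm_sub hN hqN hb (by linarith) x hε0).const_mul K
    have e : ∀ z : Euc N, (K * (‖x + z‖ ^ (-b) - ‖x‖ ^ (-b)) + (β x - β (x + z))) *
        ‖z‖ ^ (-q) = K * ((‖x + z‖ ^ (-b) - ‖x‖ ^ (-b)) * ‖z‖ ^ (-q)) +
        (β x - β (x + z)) * ‖z‖ ^ (-q) := fun z => by ring
    refine (setIntegral_sub_le_of_le_barrier hN hqN hv_int hε0
      (W := fun z => K * (‖x + z‖ ^ (-b) - ‖x‖ ^ (-b)) + (β x - β (x + z))) ?_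
      fun z hz => ?_).trans ?_
    · simp only [e]; exact i1.add (hβi ε hε0)
    · have h1 := hgle (x + z) hz
      have h2 : g (x + z) = K * ‖x + z‖ ^ (-b) - v (x + z) - β (x + z) := rfl
      linarith
    · simp only [e]
      rw [integral_add i1 (hβi ε hε0), integral_const_mul]
      refine add_le_add_right ?_ _
      exact (setIntegral_le_of_le_quadratic hN (by linarith) (by positivity) hε0 hε hbump
        (hβi ε hε0)).trans (add_le_add_right hfar _)
  clear_value q I₁ I₃ E h₀
  have hEe : E = η * ((I₁ + I₃) * (2:ℝ)⁻¹ ^ (-(2 * s)) * r ^ (-(N:ℝ))) := by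
    have e1 : ρ ^ ((N:ℝ) + 2 - q) = ρ ^ (-(2 * s)) * ρ ^ 2 := by
      rw [← Real.rpow_natCast, ← Real.rpow_add hρ0, hq]; push_cast; ring_nf
    have e2 : ρ ^ ((N:ℝ) - q) = ρ ^ (-(2 * s)) := by rw [hq]; ring_nf
    have e3 : ρ ^ (-(2 * s)) = (2:ℝ)⁻¹ ^ (-(2 * s)) * r ^ (-(2 * s)) := by
      rw [hρ, div_eq_inv_mul, Real.mul_rpow (by norm_num) hr0.le]
    have e4 : r ^ (-(N:ℝ)) = r ^ (-(2 * s)) * r ^ (-b) := by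
      rw [← Real.rpow_add hr0, hbN]; ring_nf
    have e5 : h₀ / ρ ^ 2 * (I₁ * (ρ ^ (-(2 * s)) * ρ ^ 2)) = h₀ * I₁ * ρ ^ (-(2 * s)) := by
      field_simp
    rw [hE, e1, e5, e2, e3, e4, hh₀]
    ring
  have h1 : (m * r ^ (-b)) ^ p ≤
      cNs N s * (η * ((I₁ + I₃) * (2:ℝ)⁻¹ ^ (-(2 * s)) * r ^ (-(N:ℝ)))) := by
    refine (Real.rpow_le_rpow (by positivity) hvxm (by linarith)).trans ?_
    rwa [mul_zero, zero_add, hEe] at hL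
  rw [Real.mul_rpow hm.le (by positivity), ← Real.rpow_mul hr0.le] at h1
  have e3 : m ^ p = m ^ p * r ^ (-b * p) * r ^ (b * p) := by
    rw [mul_assoc, ← Real.rpow_add hr0, show -b * p + b * p = 0 by ring, Real.rpow_zero, mul_one]
  have e4 : r ^ (b * p - N) = r ^ (-(N:ℝ)) * r ^ (b * p) := by
    rw [← Real.rpow_add hr0]; ring_nf
  have h2 : r ^ (b * p - N) ≤ R ^ (b * p - N) := Real.rpow_le_rpow hr0.le hrR (by linarith)
  rw [e3]
  refine (mul_le_mul_of_nonneg_right h1 (by positivity)).trans ?_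
  have h3 : 0 ≤ cNs N s * (I₁ + I₃) * (2:ℝ)⁻¹ ^ (-(2 * s)) * η := by positivity
  have h4 := mul_le_mul_of_nonneg_left h2 h3
  rw [e4] at h4
  linarith

/-- Theorem G, part 3: for `p ≥ N/(N-2s)` the only nonnegative
solution of the fractional Emden–Fowler equation in `Ω∖{0}` vanishing outside `Ω`
is the trivial one. -/
theorem stmt18 (N : ℕ) (hN : 1 ≤ N) (s p : ℝ) (hs : s ∈ Set.Ioo (0:ℝ) 1)
    (h2s : 2*s < N) (hp : (N:ℝ)/((N:ℝ) - 2*s) ≤ p)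
    (Ω : Set (Euc N)) (hΩo : IsOpen Ω) (hΩc : IsConnected Ω)
    (hΩb : Bornology.IsBounded Ω) (h0 : (0:Euc N) ∈ Ω)
    (v : Euc N → ℝ)
    (hC2 : ContDiffOn ℝ 2 v (Ω \ {0}))
    (hcont : ContinuousOn v ({(0:Euc N)}ᶜ))
    (hL1 : L1mu N s v)
    (hpos : ∀ x : Euc N, 0 ≤ v x)
    (hout : ∀ x : Euc N, x ∉ Ω → v x = 0)
    (heq : ∀ x ∈ Ω \ {0}, HasFracLap N s v x (-(v x ^ p))) :
    ∀ x : Euc N, x ≠ 0 → v x = 0 := by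
  have hs0 := hs.1
  have hNr : (1:ℝ) ≤ N := by exact_mod_cast hN
  set b : ℝ := (N:ℝ) - 2 * s with hb
  have hb0 : 0 < b := by linarith
  have hbp : (N:ℝ) ≤ b * p := by rwa [div_le_iff₀ hb0, mul_comm] at hp
  have hp1 : 1 < p := by nlinarith
  obtain ⟨R, hR1, hR⟩ : ∃ R : ℝ, 1 ≤ R ∧ ∀ x ∈ Ω, ‖x‖ ≤ R := by
    obtain ⟨R, hR⟩ := hΩb.exists_norm_le
    exact ⟨max 1 R, le_max_left _ _, fun x hx => (hR x hx).trans (le_max_right _ _)⟩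
  have hv_int := hL1.integrable hs0 hΩo hR1 hR hout
  set γ : ℝ := (N:ℝ) - 4 * s ^ 2 / N with hγ
  have hbγ : b ≤ γ := by
    have : 4 * s ^ 2 / N ≤ 2 * s := by
      rw [div_le_iff₀ (by linarith)]; nlinarith
    linarith
  have hγN : γ < N := by
    have : 0 < 4 * s ^ 2 / (N:ℝ) := by positivity
    linarith
  have hγp : (N:ℝ) + 2 * s ≤ γ * p := by
    have e : γ = ((N:ℝ) + 2 * s) / N * b := by
      rw [hγ, hb]; field_simp; ring
    rw [e, mul_assoc]
    calc (N:ℝ) + 2 * s = ((N:ℝ) + 2 * s) / N * N := by field_simp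
      _ ≤ _ := by gcongr
  obtain ⟨C₀, hC₀, hv₀⟩ := exists_le_mul_rpow_neg hN hs hp1 hR1 hR hcont hv_int hpos hout heq
    (γ := γ) (by linarith) (by linarith) hγp
  obtain ⟨C₁, hC₁, hv₁⟩ := exists_le_mul_rpow_neg_of_le hN hs hp1 hR1 hR hcont hv_int hpos hout heq
    (γ := γ) (τ := (γ + N) / 2) (b := b) (by linarith) (by linarith) (by linarith) hb0.le
    (by linarith) (by linarith) hC₀ hv₀
  obtain ⟨C, hC, hfund⟩ := exists_rpow_le_mul_of_le_fundamental hN hs hp1 hR1 hR hcont hv_int hout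
    heq hb0.le hb hbp
  intro x₁ hx₁
  by_contra hne
  have hvx₁ : 0 < v x₁ := (hpos x₁).lt_of_ne (Ne.symm hne)
  set S : Set ℝ := (fun x : Euc N => v x * ‖x‖ ^ b) '' {x | x ≠ 0} with hS
  have hSb : BddAbove S := by
    refine ⟨C₁, ?_⟩
    rintro _ ⟨x, hx, rfl⟩
    have hxp := norm_pos_iff.2 hx
    have h := hv₁ x hx
    rwa [Real.rpow_neg hxp.le, ← div_eq_mul_inv, le_div_iff₀ (by positivity)] at h
  set K := sSup S with hK
  have hle : ∀ x : Euc N, x ≠ 0 → v x ≤ K * ‖x‖ ^ (-b) := by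
    intro x hx
    have hxp := norm_pos_iff.2 hx
    rw [Real.rpow_neg hxp.le, ← div_eq_mul_inv, le_div_iff₀ (by positivity)]
    exact le_csSup hSb ⟨x, hx, rfl⟩
  have hK0 : 0 < K := by
    have hxp := norm_pos_iff.2 hx₁
    exact lt_of_lt_of_le (by positivity : 0 < v x₁ * ‖x₁‖ ^ b) (le_csSup hSb ⟨x₁, hx₁, rfl⟩)
  set m := K * (3 / 2 : ℝ) ^ (-b) / 2 with hm
  have hm0 : 0 < m := by positivity
  set η := min m (m ^ p / (2 * (C + 1))) with hη
  have hη0 : 0 < η := lt_min hm0 (by positivity)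
  obtain ⟨_, ⟨x, hx, rfl⟩, hxK⟩ := exists_lt_of_lt_csSup (s := S) ⟨_, x₁, hx₁, rfl⟩
    (show K - η < sSup S by linarith)
  have hxp := norm_pos_iff.2 hx
  have h := hfund K m η hm0 hη0 (min_le_left _ _) (by rw [hm]; ring) hle ⟨x, hx, by
    rw [Real.rpow_neg hxp.le, ← div_eq_mul_inv, div_lt_iff₀ (by positivity)]; exact hxK⟩
  have h2 : C * η ≤ C * (m ^ p / (2 * (C + 1))) :=
    mul_le_mul_of_nonneg_left (min_le_right _ _) hC
  have hmp : 0 < m ^ p := by positivity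
  have h3 : C * (m ^ p / (2 * (C + 1))) < m ^ p := by
    rw [← mul_div_assoc, div_lt_iff₀ (by positivity)]
    nlinarith
  linarith
end
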